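/- Let E ⊂ ℝ^n be bounded and nonempty and let m ∈ {1,…,n−1}. Then for γ_{n,m}-almost all V ∈ G(n,m), simultaneously for all θ ∈ (0,1], \underline{dim}_θ (π_V E) = \underline{dim}_θ^m E and \overline{dim}_θ (π_V E) = \overline{dim}_θ^m E. -/

import Mathlib

open MeasureTheory Metric Set Filter Topology
open scoped ENNReal NNReal

noncomputable section

/-- Euclidean space `ℝ^n`. -/
abbrev Euc (n : ℕ) := EuclideanSpace ℝ (Fin n)

instance matrixMeasurableSpace (n : ℕ) : MeasurableSpace (Matrix (Fin n) (Fin n) ℝ) :=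
  inferInstanceAs (MeasurableSpace (Fin n → Fin n → ℝ))

/-- The restricted covering sum `S_{r,θ}^s(E)`: the infimum of `Σ_i |U_i|^s` over all
countable covers `{U_i}` of `E` with `r ≤ |U_i| ≤ r^θ`, valued in `ℝ≥0∞`. -/
def coverSum (n : ℕ) (E : Set (Euc n)) (θ s r : ℝ) : ℝ≥0∞ :=
  sInf { T : ℝ≥0∞ | ∃ 𝒰 : Set (Set (Euc n)), 𝒰.Countable ∧ E ⊆ ⋃₀ 𝒰 ∧
    (∀ U ∈ 𝒰, r ≤ diam U ∧ diam U ≤ r ^ θ) ∧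
    T = ∑' U : 𝒰, ENNReal.ofReal (diam (U : Set (Euc n)) ^ s) }

/-- Real-valued version of `coverSum`. -/
def Sval (n : ℕ) (E : Set (Euc n)) (θ s r : ℝ) : ℝ := (coverSum n E θ s r).toReal

/-- The quotient `log S_{r,θ}^s(E) / (-log r)`. -/
def Squot (n : ℕ) (E : Set (Euc n)) (θ s r : ℝ) : ℝ :=
  Real.log (Sval n E θ s r) / (-Real.log r)

/-- `N_δ(E)`: the smallest number of sets of diameter at most `δ` needed to cover `E`. -/
def covNum (n : ℕ) (E : Set (Euc n)) (δ : ℝ) : ℕ :=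
  sInf { k : ℕ | ∃ U : Fin k → Set (Euc n), E ⊆ ⋃ i, U i ∧ ∀ i, diam (U i) ≤ δ }

/-- The lower box-counting dimension of `E`. -/
def lowerBoxDim (n : ℕ) (E : Set (Euc n)) : ℝ :=
  liminf (fun δ : ℝ => Real.log (covNum n E δ) / (-Real.log δ)) (𝓝[>] 0)

/-- The upper box-counting dimension of `E`. -/
def upperBoxDim (n : ℕ) (E : Set (Euc n)) : ℝ :=
  limsup (fun δ : ℝ => Real.log (covNum n E δ) / (-Real.log δ)) (𝓝[>] 0)

/-- The kernel `φ_{r,θ}^{s,m}`. -/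
def phiK (n : ℕ) (m s θ r : ℝ) (x : Euc n) : ℝ :=
  if ‖x‖ < r then 1
  else if ‖x‖ < r ^ θ then (r / ‖x‖) ^ s
  else r ^ (θ * (m - s) + s) / ‖x‖ ^ m

/-- The kernel `φ̃_{r,θ}^s`. -/
def phiT (n : ℕ) (s θ r : ℝ) (x : Euc n) : ℝ :=
  if ‖x‖ < r then 1
  else if ‖x‖ ≤ r ^ θ then (r / ‖x‖) ^ s
  else 0

/-- The kernel `φ_r^m(x) = min{1, (r/|x|)^m}`. -/
def phiB (n : ℕ) (m r : ℝ) (x : Euc n) : ℝ :=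
  if ‖x‖ ≤ r then 1 else (r / ‖x‖) ^ m

/-- The energy `∬ φ(x-y) dμ(x)dμ(y)` of a measure with respect to a kernel `φ`. -/
def energy (n : ℕ) (φ : Euc n → ℝ) (μ : Measure (Euc n)) : ℝ :=
  ∫ x, ∫ y, φ (x - y) ∂μ ∂μ

/-- The potential `∫ φ(x-y) dμ(y)` of a measure at `x` with respect to a kernel `φ`. -/
def potential (n : ℕ) (φ : Euc n → ℝ) (μ : Measure (Euc n)) (x : Euc n) : ℝ :=
  ∫ y, φ (x - y) ∂μ

/-- `μ` is a Borel probability measure supported on `E`. -/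
def PMeasOn (n : ℕ) (E : Set (Euc n)) (μ : Measure (Euc n)) : Prop :=
  IsProbabilityMeasure μ ∧ μ Eᶜ = 0

/-- The capacity `C_{r,θ}^{s,m}(E)`: the reciprocal of the infimal energy of Borel
probability measures supported on `E` with respect to the kernel `φ_{r,θ}^{s,m}`. -/
def capacity (n : ℕ) (m s θ r : ℝ) (E : Set (Euc n)) : ℝ :=
  (sInf { e : ℝ | ∃ μ : Measure (Euc n), PMeasOn n E μ ∧ e = energy n (phiK n m s θ r) μ })⁻¹

/-- The quotient `log C_{r,θ}^{s,m}(E) / (-log r)`. -/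
def Cquot (n : ℕ) (m s θ : ℝ) (E : Set (Euc n)) (r : ℝ) : ℝ :=
  Real.log (capacity n m s θ r E) / (-Real.log r)

/-- `d` is the lower intermediate dimension `\underline{dim}_θ E`, i.e. the unique
`s ∈ [0,n]` such that `liminf_{r→0} log S_{r,θ}^s(E) / (-log r) = 0`. -/
def IsLowerInterDim (n : ℕ) (θ : ℝ) (E : Set (Euc n)) (d : ℝ) : Prop :=
  d ∈ Icc (0:ℝ) n ∧ liminf (fun r => Squot n E θ d r) (𝓝[>] 0) = 0

/-- `d` is the upper intermediate dimension `\overline{dim}_θ E`. -/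
def IsUpperInterDim (n : ℕ) (θ : ℝ) (E : Set (Euc n)) (d : ℝ) : Prop :=
  d ∈ Icc (0:ℝ) n ∧ limsup (fun r => Squot n E θ d r) (𝓝[>] 0) = 0

/-- `d` is the lower intermediate dimension profile `\underline{dim}_θ^m E`, i.e. the unique
`s ∈ [0,m]` such that `liminf_{r→0} log C_{r,θ}^{s,m}(E) / (-log r) = s`; for bounded sets the
capacity is that of the closure. -/
def IsLowerDimProfile (n m : ℕ) (θ : ℝ) (E : Set (Euc n)) (d : ℝ) : Prop :=
  d ∈ Icc (0:ℝ) m ∧ liminf (fun r => Cquot n m d θ (closure E) r) (𝓝[>] 0) = d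

/-- `d` is the upper intermediate dimension profile `\overline{dim}_θ^m E`. -/
def IsUpperDimProfile (n m : ℕ) (θ : ℝ) (E : Set (Euc n)) (d : ℝ) : Prop :=
  d ∈ Icc (0:ℝ) m ∧ limsup (fun r => Cquot n m d θ (closure E) r) (𝓝[>] 0) = d

/-- `P` is the matrix of an orthogonal projection of `ℝ^n` onto an `m`-dimensional subspace;
such matrices parametrise the Grassmannian `G(n,m)`. -/
def IsProjMat (n m : ℕ) (P : Matrix (Fin n) (Fin n) ℝ) : Prop :=
  P.transpose = P ∧ P * P = P ∧ P.rank = m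

/-- The orthogonal projection map `π_V` associated to a projection matrix. -/
def projMap (n : ℕ) (P : Matrix (Fin n) (Fin n) ℝ) : Euc n → Euc n :=
  fun x => Matrix.toEuclideanLin P x

/-- `γ` is the natural invariant measure `γ_{n,m}` on the Grassmannian `G(n,m)` (realised as
the space of orthogonal projection matrices of rank `m`): a probability measure supported on
the rank-`m` orthogonal projections and invariant under the action of the orthogonal group. -/
def IsGrassMeasure (n m : ℕ) (γ : Measure (Matrix (Fin n) (Fin n) ℝ)) : Prop :=
  IsProbabilityMeasure γ ∧ γ {P | IsProjMat n m P}ᶜ = 0 ∧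
  ∀ A ∈ Matrix.orthogonalGroup (Fin n) ℝ,
    Measure.map (fun P => A * P * A.transpose) γ = γ

/-- The radial profile of the kernel `phiK`. -/
def phiRad (m s θ r t : ℝ) : ℝ :=
  if t < r then 1 else if t < r ^ θ then (r / t) ^ s else r ^ (θ * (m - s) + s) / t ^ m

lemma phiK_eq_phiRad (n : ℕ) (m s θ r : ℝ) (x : Euc n) :
    phiK n m s θ r x = phiRad m s θ r ‖x‖ := rfl

/-- Admissible parameters for the kernel. -/
structure KParam (m s θ r : ℝ) : Prop where
  r_pos : 0 < r
  r_lt_one : r < 1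
  θ_pos : 0 < θ
  θ_le_one : θ ≤ 1
  s_nonneg : 0 ≤ s
  s_le : s ≤ m

namespace KParam

variable {m s θ r : ℝ} (h : KParam m s θ r)
include h

lemma r_le_rpow : r ≤ r ^ θ := by
  have := Real.rpow_le_rpow_of_exponent_ge h.r_pos h.r_lt_one.le h.θ_le_one
  simpa using this

lemma rpow_lt_one : r ^ θ < 1 := Real.rpow_lt_one h.r_pos.le h.r_lt_one h.θ_pos

lemma m_nonneg : 0 ≤ m := h.s_nonneg.trans h.s_le

lemma third_eq {t : ℝ} (ht : 0 < t) :
    r ^ (θ * (m - s) + s) / t ^ m = (r ^ θ / t) ^ (m - s) * (r / t) ^ s := by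
  have hr := h.r_pos
  rw [Real.div_rpow (by positivity) ht.le, Real.div_rpow hr.le ht.le, Real.rpow_add hr,
    Real.rpow_mul hr.le, div_mul_div_comm, ← Real.rpow_add ht, sub_add_cancel]

lemma phiRad_le_one (t : ℝ) : phiRad m s θ r t ≤ 1 := by
  have hr := h.r_pos
  unfold phiRad
  split_ifs with h1 h2
  · exact le_rfl
  · push Not at h1
    have ht : 0 < t := hr.trans_le h1
    exact Real.rpow_le_one (by positivity) ((div_le_one ht).2 h1) h.s_nonneg
  · push Not at h1 h2
    have ht : 0 < t := hr.trans_le h1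
    rw [h.third_eq ht]
    refine mul_le_one₀ ?_ (by positivity) ?_
    · exact Real.rpow_le_one (by positivity) ((div_le_one ht).2 h2) (sub_nonneg.2 h.s_le)
    · exact Real.rpow_le_one (by positivity) ((div_le_one ht).2 h1) h.s_nonneg

lemma phiRad_le_second {t : ℝ} (ht : 0 < t) : phiRad m s θ r t ≤ (r / t) ^ s := by
  have hr := h.r_pos
  unfold phiRad
  split_ifs with h1 h2
  · exact Real.one_le_rpow ((one_le_div ht).2 h1.le) h.s_nonneg
  · exact le_rfl
  · push Not at h1 h2
    rw [h.third_eq ht]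
    refine mul_le_of_le_one_left (by positivity) ?_
    exact Real.rpow_le_one (by positivity) ((div_le_one ht).2 h2) (sub_nonneg.2 h.s_le)

lemma phiRad_le_third {t : ℝ} (ht : 0 < t) :
    phiRad m s θ r t ≤ r ^ (θ * (m - s) + s) / t ^ m := by
  have hr := h.r_pos
  unfold phiRad
  split_ifs with h1 h2
  · rw [h.third_eq ht]
    refine one_le_mul_of_one_le_of_one_le ?_ ?_
    · exact Real.one_le_rpow ((one_le_div ht).2 (h1.le.trans h.r_le_rpow)) (sub_nonneg.2 h.s_le)
    · exact Real.one_le_rpow ((one_le_div ht).2 h1.le) h.s_nonneg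
  · rw [h.third_eq ht]
    refine le_mul_of_one_le_left (by positivity) ?_
    exact Real.one_le_rpow ((one_le_div ht).2 h2.le) (sub_nonneg.2 h.s_le)
  · exact le_rfl

omit h in
lemma le_phiRad {a t : ℝ} (h1 : a ≤ 1) (h2 : a ≤ (r / t) ^ s)
    (h3 : a ≤ r ^ (θ * (m - s) + s) / t ^ m) : a ≤ phiRad m s θ r t := by
  unfold phiRad
  split_ifs <;> assumption

lemma phiRad_pos (t : ℝ) : 0 < phiRad m s θ r t := by
  have hr := h.r_pos
  unfold phiRad
  split_ifs with h1 h2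
  · exact one_pos
  all_goals
    push Not at h1
    have ht : 0 < t := hr.trans_le h1
    positivity

lemma phiRad_antitone {t u : ℝ} (ht : 0 ≤ t) (htu : t ≤ u) :
    phiRad m s θ r u ≤ phiRad m s θ r t := by
  have hr := h.r_pos
  rcases ht.eq_or_lt with rfl | ht
  · refine (h.phiRad_le_one u).trans_eq ?_
    simp [phiRad, hr]
  have hu := ht.trans_le htu
  have hm := h.m_nonneg
  have hs := h.s_nonneg
  refine le_phiRad (h.phiRad_le_one u) ((h.phiRad_le_second hu).trans ?_)
    ((h.phiRad_le_third hu).trans ?_) <;> gcongr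

lemma phiRad_le_mul_of_le {t u l : ℝ} (hl : 1 ≤ l) (hu : 0 < u) (htu : t ≤ l * u) (ht : 0 < t) :
    phiRad m s θ r u ≤ l ^ m * phiRad m s θ r t := by
  have hr := h.r_pos
  have hm := h.m_nonneg
  have hs := h.s_nonneg
  have hl0 : 0 < l := by positivity
  have hlm : 1 ≤ l ^ m := Real.one_le_rpow hl hm
  rw [← div_le_iff₀' (by positivity)]
  refine le_phiRad ?_ ?_ ?_
  · exact div_le_one_of_le₀ ((h.phiRad_le_one u).trans hlm) (by positivity)
  · calc phiRad m s θ r u / l ^ m ≤ (r / u) ^ s / l ^ s := by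
          gcongr
          · exact h.phiRad_le_second hu
          · exact h.s_le
      _ = (r / (l * u)) ^ s := by rw [← Real.div_rpow (by positivity) hl0.le]; congr 1; field_simp
      _ ≤ _ := by gcongr
  · calc phiRad m s θ r u / l ^ m ≤ (r ^ (θ * (m - s) + s) / u ^ m) / l ^ m := by
          gcongr
          exact h.phiRad_le_third hu
      _ = r ^ (θ * (m - s) + s) / (l * u) ^ m := by
          rw [Real.mul_rpow hl0.le hu.le]; field_simp
      _ ≤ _ := by gcongr

lemma le_phiRad_of_le {t D : ℝ} (ht0 : 0 ≤ t) (ht : t ≤ D) (hD : 1 ≤ D) :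
    (r / D) ^ m ≤ phiRad m s θ r t := by
  have hr := h.r_pos
  have hm := h.m_nonneg
  have hs := h.s_nonneg
  refine le_trans ?_ (h.phiRad_antitone ht0 ht)
  have h1 : r / D ≤ 1 := (div_le_one (by positivity)).2 (h.r_lt_one.le.trans hD)
  refine le_phiRad (Real.rpow_le_one (by positivity) h1 hm)
    (Real.rpow_le_rpow_of_exponent_ge (by positivity) h1 h.s_le) ?_
  rw [Real.div_rpow hr.le (by positivity)]
  gcongr ?_ / _
  refine Real.rpow_le_rpow_of_exponent_ge hr h.r_lt_one.le ?_
  nlinarith [h.θ_le_one, h.s_le]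

lemma cover_weight {ρ : ℝ} (hρ : r ≤ ρ) :
    (ρ / min ρ (r ^ θ)) ^ m * (min ρ (r ^ θ)) ^ s = r ^ s / phiRad m s θ r ρ := by
  have hr := h.r_pos
  have hρ0 : 0 < ρ := hr.trans_le hρ
  have hrθ : 0 < r ^ θ := by positivity
  unfold phiRad
  rw [if_neg hρ.not_gt]
  split_ifs with h1
  · rw [min_eq_left h1.le, div_self hρ0.ne', Real.one_rpow, Real.div_rpow hr.le hρ0.le]
    field_simp
  · push Not at h1
    rw [min_eq_right h1, h.third_eq hρ0, Real.div_rpow hρ0.le hrθ.le,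
      Real.div_rpow hrθ.le hρ0.le, Real.div_rpow hr.le hρ0.le, Real.rpow_sub hrθ,
      Real.rpow_sub hρ0]
    field_simp

lemma average_weight {ρ t : ℝ} (h1 : r ≤ ρ) (h2 : ρ ≤ r ^ θ) (ht : 0 < t) :
    (r / ρ) ^ s * min 1 ((ρ / t) ^ m) ≤ phiRad m s θ r t := by
  have hr := h.r_pos
  have hρ0 : 0 < ρ := hr.trans_le h1
  have hm := h.m_nonneg
  have hs := h.s_nonneg
  have hrρ : (r / ρ) ^ s ≤ 1 := Real.rpow_le_one (by positivity) ((div_le_one hρ0).2 h1) hs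
  refine le_phiRad ?_ ?_ ?_
  · exact mul_le_one₀ hrρ (by positivity) (min_le_left _ _)
  · have : min 1 ((ρ / t) ^ m) ≤ (ρ / t) ^ s := by
      rcases le_total 1 (ρ / t) with h | h'
      · exact (min_le_left _ _).trans (Real.one_le_rpow h hs)
      · exact (min_le_right _ _).trans
          (Real.rpow_le_rpow_of_exponent_ge (by positivity) h' h.s_le)
    calc _ ≤ (r / ρ) ^ s * (ρ / t) ^ s := by gcongr
      _ = _ := by
        rw [← Real.mul_rpow (by positivity) (by positivity)]; congr 1; field_simp
  · calc _ ≤ (r / ρ) ^ s * (ρ / t) ^ m := by gcongr; exact min_le_right _ _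
      _ = r ^ s * ρ ^ (m - s) / t ^ m := by
        rw [Real.div_rpow hr.le hρ0.le, Real.div_rpow hρ0.le ht.le, Real.rpow_sub hρ0]; field_simp
      _ ≤ r ^ s * (r ^ θ) ^ (m - s) / t ^ m := by
        gcongr
        exact sub_nonneg.2 h.s_le
      _ = _ := by rw [← Real.rpow_mul hr.le, ← Real.rpow_add hr, add_comm]

lemma phiRad_comparison {s' θ' r' : ℝ} (h' : KParam m s' θ' r') (hs : s' ≤ s) (hθ : θ' ≤ θ)
    (hr : r' ≤ r) (t : ℝ) :
    phiRad m s' θ' r' t ≤ r ^ (-((s - s') + (θ - θ') * m)) * phiRad m s θ r t := by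
  have hr0 := h.r_pos
  have hr0' := h'.r_pos
  have hm := h.m_nonneg
  have hs0 := h'.s_nonneg
  have hκ : 0 ≤ (s - s') + (θ - θ') * m :=
    add_nonneg (sub_nonneg.2 hs) (mul_nonneg (sub_nonneg.2 hθ) hm)
  have hone : 1 ≤ r ^ (-((s - s') + (θ - θ') * m)) :=
    Real.one_le_rpow_of_pos_of_le_one_of_nonpos hr0 h.r_lt_one.le (neg_nonpos.2 hκ)
  have hexp : 0 ≤ θ' * (m - s') + s' :=
    add_nonneg (mul_nonneg h'.θ_pos.le (sub_nonneg.2 h'.s_le)) hs0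
  conv_rhs => rw [phiRad]
  split_ifs with h1 h2
  · rw [mul_one]
    exact (h'.phiRad_le_one t).trans hone
  · push Not at h1
    have ht0 : 0 < t := hr0.trans_le h1
    have ht1 : t ≤ 1 := h2.le.trans h.rpow_lt_one.le
    calc phiRad m s' θ' r' t ≤ (r' / t) ^ s' := h'.phiRad_le_second ht0
      _ ≤ (r / t) ^ s' := by gcongr
      _ = (r / t) ^ (-(s - s')) * (r / t) ^ s := by
        rw [← Real.rpow_add (by positivity)]; congr 1; ring
      _ ≤ r ^ (-((s - s') + (θ - θ') * m)) * (r / t) ^ s := by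
        gcongr
        calc (r / t) ^ (-(s - s')) ≤ r ^ (-(s - s')) :=
              Real.rpow_le_rpow_of_nonpos hr0 (le_div_self hr0.le ht0 ht1) (by linarith)
          _ ≤ _ := by
            refine Real.rpow_le_rpow_of_exponent_ge hr0 h.r_lt_one.le ?_
            nlinarith [mul_nonneg (sub_nonneg.2 hθ) hm]
  · push Not at h1
    have ht0 : 0 < t := hr0.trans_le h1
    calc phiRad m s' θ' r' t ≤ r' ^ (θ' * (m - s') + s') / t ^ m := h'.phiRad_le_third ht0
      _ ≤ r ^ (θ' * (m - s') + s') / t ^ m := by gcongr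
      _ ≤ r ^ (-((s - s') + (θ - θ') * m) + (θ * (m - s) + s)) / t ^ m := by
        gcongr ?_ / _
        refine Real.rpow_le_rpow_of_exponent_ge hr0 h.r_lt_one.le ?_
        nlinarith [mul_nonneg (sub_nonneg.2 hs) h'.θ_pos.le, mul_nonneg (sub_nonneg.2 hθ) hs0,
          mul_nonneg (sub_nonneg.2 hθ) h.s_nonneg]
      _ = _ := by rw [Real.rpow_add hr0]; ring

end KParam

lemma measurable_phiRad (m s θ r : ℝ) : Measurable (phiRad m s θ r) := by
  unfold phiRad
  refine Measurable.ite measurableSet_Iio measurable_const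
    (Measurable.ite measurableSet_Iio ?_ ?_) <;> fun_prop

lemma projMap_sub (n : ℕ) (P : Matrix (Fin n) (Fin n) ℝ) (x y : Euc n) :
    projMap n P x - projMap n P y = projMap n P (x - y) := by
  simp [projMap]

lemma continuous_projMap (n : ℕ) (P : Matrix (Fin n) (Fin n) ℝ) : Continuous (projMap n P) :=
  (Matrix.toEuclideanLin P).continuous_of_finiteDimensional

lemma measurable_projMap_uncurry (n : ℕ) :
    Measurable fun p : Matrix (Fin n) (Fin n) ℝ × Euc n => projMap n p.1 p.2 := by
  have hentry : ∀ i j : Fin n, Measurable fun P : Matrix (Fin n) (Fin n) ℝ => P i j := fun i j =>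
    (measurable_pi_apply j).comp (measurable_pi_apply i)
  have h : Measurable fun p : Matrix (Fin n) (Fin n) ℝ × Euc n =>
      fun i => ∑ j, p.1 i j * p.2 j := by
    refine measurable_pi_lambda _ fun i => Finset.measurable_sum _ fun j _ => ?_
    exact ((hentry i j).comp measurable_fst).mul (by fun_prop)
  exact (WithLp.measurable_toLp 2 _).comp h

/-- An orthogonal projection is diagonal in some orthonormal basis. -/
lemma IsProjMat.exists_basis {n m : ℕ} {P : Matrix (Fin n) (Fin n) ℝ} (hP : IsProjMat n m P) :
    ∃ (b : OrthonormalBasis (Fin n) ℝ (Euc n)) (I : Finset (Fin n)), I.card = m ∧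
      ∀ x i, b.repr (projMap n P x) i = if i ∈ I then b.repr x i else 0 := by
  classical
  obtain ⟨hT, hsq, hrank⟩ := hP
  have hH : P.IsHermitian := by
    rw [Matrix.IsHermitian, Matrix.conjTranspose_eq_transpose_of_trivial, hT]
  have hsymm := Matrix.isSymmetric_toEuclideanLin_iff.mpr hH
  have heig : ∀ i, projMap n P (hH.eigenvectorBasis i) =
      hH.eigenvalues i • hH.eigenvectorBasis i := by
    intro i
    ext j
    have := congrFun (hH.mulVec_eigenvectorBasis i) j
    simpa [projMap, Matrix.toLpLin_apply] using this
  have hval : ∀ i, hH.eigenvalues i ≠ 0 → hH.eigenvalues i = 1 := by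
    intro i hi
    have h1 : projMap n P (projMap n P (hH.eigenvectorBasis i)) =
        projMap n P (hH.eigenvectorBasis i) := by
      simp only [projMap, Matrix.toLpLin_apply]
      rw [WithLp.ofLp_toLp, Matrix.mulVec_mulVec, hsq]
    rw [heig] at h1
    have h2 : projMap n P (hH.eigenvalues i • hH.eigenvectorBasis i) =
        hH.eigenvalues i • projMap n P (hH.eigenvectorBasis i) := by simp [projMap]
    rw [h2, heig] at h1
    have h3 := smul_right_injective (Euc n) hi h1
    have h4 : (hH.eigenvalues i - 1) • hH.eigenvectorBasis i = 0 := by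
      rw [sub_smul, h3, one_smul, sub_self]
    rcases smul_eq_zero.1 h4 with h | h
    · linarith
    · exact absurd h (hH.eigenvectorBasis.orthonormal.ne_zero i)
  refine ⟨hH.eigenvectorBasis, Finset.univ.filter fun i => hH.eigenvalues i ≠ 0, ?_, ?_⟩
  · rw [← hrank, hH.rank_eq_card_non_zero_eigs, Fintype.card_subtype]
  · intro x i
    have : inner ℝ (hH.eigenvectorBasis i) (projMap n P x) =
        hH.eigenvalues i * inner ℝ (hH.eigenvectorBasis i) x := by
      have h5 : inner ℝ (projMap n P (hH.eigenvectorBasis i)) x =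
        inner ℝ (hH.eigenvectorBasis i) (projMap n P x) := hsymm _ _
      rw [← h5, heig, real_inner_smul_left]
    rw [OrthonormalBasis.repr_apply_apply, OrthonormalBasis.repr_apply_apply, this]
    simp only [Finset.mem_filter, Finset.mem_univ, true_and]
    split_ifs with h
    · rw [hval i h, one_mul]
    · push Not at h
      rw [h, zero_mul]

lemma IsProjMat.norm_projMap_le {n m : ℕ} {P : Matrix (Fin n) (Fin n) ℝ} (hP : IsProjMat n m P)
    (x : Euc n) : ‖projMap n P x‖ ≤ ‖x‖ := by
  obtain ⟨b, I, -, hb⟩ := hP.exists_basis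
  rw [← b.repr.norm_map, ← b.repr.norm_map x, EuclideanSpace.norm_eq, EuclideanSpace.norm_eq]
  refine Real.sqrt_le_sqrt (Finset.sum_le_sum fun i _ => ?_)
  rw [hb]
  split_ifs
  · exact le_rfl
  · simpa using sq_nonneg _

/-- The part of the unit ball projecting into a ball of radius `ρ` has volume `O(ρ ^ m)`. -/
lemma IsProjMat.volume_le {n m : ℕ} {P : Matrix (Fin n) (Fin n) ℝ} (hP : IsProjMat n m P)
    {ρ : ℝ} (hρ : 0 ≤ ρ) :
    volume {x : Euc n | ‖x‖ ≤ 1 ∧ ‖projMap n P x‖ ≤ ρ} ≤ ENNReal.ofReal (2 ^ n * ρ ^ m) := by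
  classical
  obtain ⟨b, I, hI, hb⟩ := hP.exists_basis
  let S : Set (Fin n → ℝ) := Set.univ.pi fun i =>
    Icc (-(if i ∈ I then ρ else 1)) (if i ∈ I then ρ else 1)
  have hS : MeasurableSet S := MeasurableSet.univ_pi fun i => measurableSet_Icc
  have hmp := (EuclideanSpace.volume_preserving_symm_measurableEquiv_toLp (Fin n)).comp
    b.measurePreserving_repr
  calc volume {x : Euc n | ‖x‖ ≤ 1 ∧ ‖projMap n P x‖ ≤ ρ}
      ≤ volume (((MeasurableEquiv.toLp 2 (Fin n → ℝ)).symm ∘ b.repr) ⁻¹' S) := by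
        refine measure_mono fun x hx => ?_
        simp only [S, mem_preimage, Set.mem_univ_pi]
        intro i
        change b.repr x i ∈ _
        rw [mem_Icc, ← abs_le]
        split_ifs with h
        · have h1 := PiLp.norm_apply_le (b.repr (projMap n P x)) i
          rw [hb, if_pos h, b.repr.norm_map] at h1
          exact h1.trans hx.2
        · have h1 := PiLp.norm_apply_le (b.repr x) i
          rw [b.repr.norm_map] at h1
          exact h1.trans hx.1
    _ = volume S := hmp.measure_preimage hS.nullMeasurableSet
    _ = ENNReal.ofReal (2 ^ n * ρ ^ m) := by
        have h1 : ∀ i, (if i ∈ I then ρ else 1) - -(if i ∈ I then ρ else 1) =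
            2 * (if i ∈ I then ρ else 1) := fun i => by ring
        rw [volume_pi_pi]
        simp only [Real.volume_Icc, h1]
        rw [← ENNReal.ofReal_prod_of_nonneg
          (fun i _ => by split_ifs <;> positivity), Finset.prod_mul_distrib]
        simp [Finset.prod_ite_mem, hI]

/-- Balls in the range of a rank `m` projection have covering numbers of order `(ρ / δ) ^ m`. -/
lemma IsProjMat.exists_centers {n m : ℕ} (hn : 0 < n) {P : Matrix (Fin n) (Fin n) ℝ}
    (hP : IsProjMat n m P) {ρ δ : ℝ} (hδ : 0 < δ) (hδρ : δ ≤ ρ) (x : Euc n) :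
    ∃ Z : Finset (Euc n), (Z.card : ℝ) ≤ (25 * n * (ρ / δ)) ^ m ∧
      ∀ y, ‖projMap n P y - projMap n P x‖ ≤ 5 * ρ → ∃ z ∈ Z, ‖projMap n P y - z‖ ≤ δ / 2 := by
  classical
  obtain ⟨b, I, hI, hb⟩ := hP.exists_basis
  have hn1 : (1 : ℝ) ≤ n := by exact_mod_cast hn
  have hρ : 0 < ρ := hδ.trans_le hδρ
  set d : ℝ := δ / (2 * n) with hd
  have hd0 : 0 < d := by positivity
  set N : ℕ := ⌈5 * ρ / d⌉₊ + 1 with hN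
  let K : Finset (Fin n → ℤ) :=
    Fintype.piFinset fun i => if i ∈ I then Finset.Icc (-(N : ℤ)) N else {0}
  let z : (Fin n → ℤ) → Euc n := fun k =>
    projMap n P x + b.repr.symm (WithLp.toLp 2 fun i => d * k i)
  refine ⟨K.image z, ?_, ?_⟩
  · have hK : K.card = (2 * N + 1) ^ m := by
      have : ∀ i, (if i ∈ I then Finset.Icc (-(N : ℤ)) N else {0}).card =
          if i ∈ I then 2 * N + 1 else 1 := by
        intro i
        split_ifs
        · rw [Int.card_Icc]; omega
        · simp
      rw [Fintype.card_piFinset]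
      simp only [this]
      simp [Finset.prod_ite_mem, hI]
    calc ((K.image z).card : ℝ) ≤ K.card := by exact_mod_cast Finset.card_image_le
      _ = (2 * N + 1 : ℝ) ^ m := by rw [hK]; push_cast; rfl
      _ ≤ _ := by
        gcongr
        have h1 : (N : ℝ) ≤ 5 * ρ / d + 2 := by
          rw [hN]; push_cast
          linarith [(Nat.ceil_lt_add_one (show 0 ≤ 5 * ρ / d by positivity)).le]
        have h2 : 5 * ρ / d = 10 * (n * (ρ / δ)) := by rw [hd]; field_simp; ring
        have h3 : 1 ≤ n * (ρ / δ) := one_le_mul_of_one_le_of_one_le hn1 ((one_le_div hδ).2 hδρ)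
        rw [h2] at h1
        nlinarith
  · intro y hy
    rw [projMap_sub] at hy
    set w := b.repr (projMap n P (y - x)) with hw
    have hwle : ∀ i, |w i| ≤ 5 * ρ := fun i => by
      have := PiLp.norm_apply_le w i
      rw [hw, b.repr.norm_map] at this
      exact this.trans hy
    let k : Fin n → ℤ := fun i => ⌊w i / d⌋
    refine ⟨z k, Finset.mem_image_of_mem _ ?_, ?_⟩
    · simp only [K, Fintype.mem_piFinset]
      intro i
      split_ifs with h
      · have h1 : |w i / d| ≤ 5 * ρ / d := by
          rw [abs_div, abs_of_pos hd0]
          gcongr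
          exact hwle i
        have h2 : 5 * ρ / d ≤ N - 1 := by rw [hN]; push_cast; linarith [Nat.le_ceil (5 * ρ / d)]
        have h3 := abs_le.1 (h1.trans h2)
        rw [Finset.mem_Icc]
        constructor
        · rw [Int.le_floor]; push_cast; linarith
        · have : (⌊w i / d⌋ : ℝ) ≤ N := (Int.floor_le _).trans (by linarith)
          exact_mod_cast this
      · have : w i = 0 := by rw [hw, hb, if_neg h]
        simp [k, this]
    · have h1 : projMap n P y - z k =
          b.repr.symm (w - WithLp.toLp 2 fun i => d * k i) := by
        rw [map_sub, hw, b.repr.symm_apply_apply, ← projMap_sub]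
        simp only [z]
        abel
      rw [h1, b.repr.symm.norm_map, EuclideanSpace.norm_eq]
      have h2 : ∀ i, ‖(w - WithLp.toLp 2 fun i => d * (k i : ℝ)) i‖ ^ 2 ≤ d ^ 2 := by
        intro i
        have e1 := Int.floor_le (w i / d)
        have e2 := Int.lt_floor_add_one (w i / d)
        rw [le_div_iff₀ hd0] at e1
        rw [div_lt_iff₀ hd0] at e2
        have : |w i - d * k i| ≤ d := by
          rw [abs_le]
          simp only [k]
          constructor <;> nlinarith
        rw [PiLp.sub_apply, Real.norm_eq_abs]
        gcongr
      calc √(∑ i, ‖(w - WithLp.toLp 2 fun i => d * (k i : ℝ)) i‖ ^ 2)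
          ≤ √(∑ _i : Fin n, d ^ 2) := Real.sqrt_le_sqrt (Finset.sum_le_sum fun i _ => h2 i)
        _ ≤ √((n * d) ^ 2) := by
          refine Real.sqrt_le_sqrt ?_
          simp only [Finset.sum_const, Finset.card_univ, Fintype.card_fin, nsmul_eq_mul]
          nlinarith [sq_nonneg d]
        _ = n * d := Real.sqrt_sq (by positivity)
        _ = δ / 2 := by rw [hd]; field_simp

/-- Any two vectors of the same norm are related by an orthogonal matrix. -/
lemma exists_orthogonal_map {n : ℕ} {x y : Euc n} (h : ‖x‖ = ‖y‖) :
    ∃ A ∈ Matrix.orthogonalGroup (Fin n) ℝ, projMap n A.transpose x = y := by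
  set R : Euc n ≃ₗᵢ[ℝ] Euc n := (ℝ ∙ (x - y))ᗮ.reflection
  have hR : R x = y := Submodule.reflection_sub h
  let e := EuclideanSpace.basisFun (Fin n) ℝ
  have hmem := R.toMatrix_mem_unitaryGroup e e
  refine ⟨star (LinearMap.toMatrix e.toBasis e.toBasis R.toLinearMap), Unitary.star_mem hmem, ?_⟩
  have h1 := LinearMap.toMatrix_mulVec_repr e.toBasis e.toBasis (R : Euc n →ₗ[ℝ] Euc n) x
  rw [Matrix.star_eq_conjTranspose, Matrix.conjTranspose_eq_transpose_of_trivial,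
    Matrix.transpose_transpose, ← hR]
  ext i
  have h2 := congrFun h1 i
  exact h2

lemma norm_projMap_of_mem_orthogonalGroup {n : ℕ} {A : Matrix (Fin n) (Fin n) ℝ}
    (hA : A ∈ Matrix.orthogonalGroup (Fin n) ℝ) (x : Euc n) : ‖projMap n A x‖ = ‖x‖ := by
  rw [Matrix.mem_orthogonalGroup_iff'] at hA
  rw [← sq_eq_sq₀ (norm_nonneg _) (norm_nonneg _), EuclideanSpace.real_norm_sq_eq,
    EuclideanSpace.real_norm_sq_eq]
  have h1 : ∀ v : Fin n → ℝ, ∑ i, v i ^ 2 = v ⬝ᵥ v := fun v => by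
    simp [dotProduct, sq]
  rw [h1, h1]
  change A.mulVec x ⬝ᵥ A.mulVec x = _
  rw [Matrix.dotProduct_mulVec, ← Matrix.mulVec_transpose, Matrix.mulVec_mulVec, hA,
    Matrix.one_mulVec]

lemma projMap_mul (n : ℕ) (A B : Matrix (Fin n) (Fin n) ℝ) (x : Euc n) :
    projMap n (A * B) x = projMap n A (projMap n B x) := by
  simp only [projMap, Matrix.toLpLin_apply, Matrix.mulVec_mulVec]

lemma projMap_smul (n : ℕ) (A : Matrix (Fin n) (Fin n) ℝ) (c : ℝ) (x : Euc n) :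
    projMap n A (c • x) = c • projMap n A x := by
  simp [projMap]

lemma IsGrassMeasure.ae_isProjMat {n m : ℕ} {γ : Measure (Matrix (Fin n) (Fin n) ℝ)}
    (hγ : IsGrassMeasure n m γ) : ∀ᵐ P ∂γ, IsProjMat n m P := hγ.2.1

lemma measurable_conj (n : ℕ) (A B : Matrix (Fin n) (Fin n) ℝ) :
    Measurable fun P : Matrix (Fin n) (Fin n) ℝ => A * P * B := by
  have hentry : ∀ i j : Fin n, Measurable fun P : Matrix (Fin n) (Fin n) ℝ => P i j := fun i j =>
    (measurable_pi_apply j).comp (measurable_pi_apply i)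
  refine measurable_pi_lambda _ fun i => measurable_pi_lambda _ fun j => ?_
  simp only [Matrix.mul_apply]
  refine Finset.measurable_sum _ fun k _ => Measurable.mul_const ?_ _
  exact Finset.measurable_sum _ fun l _ => (hentry l k).const_mul _

lemma measurable_norm_projMap (n : ℕ) (x : Euc n) :
    Measurable fun P : Matrix (Fin n) (Fin n) ℝ => ‖projMap n P x‖ :=
  ((measurable_projMap_uncurry n).comp measurable_prodMk_right).norm

/-- The law of `‖π_V x‖` depends only on `‖x‖`. -/
lemma IsGrassMeasure.measure_norm_le_eq {n m : ℕ} {γ : Measure (Matrix (Fin n) (Fin n) ℝ)}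
    (hγ : IsGrassMeasure n m γ) {x y : Euc n} (h : ‖x‖ = ‖y‖) (ρ : ℝ) :
    γ {P | ‖projMap n P x‖ ≤ ρ} = γ {P | ‖projMap n P y‖ ≤ ρ} := by
  obtain ⟨A, hA, hxy⟩ := exists_orthogonal_map h
  conv_lhs => rw [← hγ.2.2 A hA]
  rw [Measure.map_apply (measurable_conj n A A.transpose)
    (measurableSet_le (measurable_norm_projMap n x) measurable_const)]
  congr 1
  ext P
  simp only [mem_preimage, mem_ofPred_eq]
  rw [projMap_mul, projMap_mul, hxy, norm_projMap_of_mem_orthogonalGroup hA]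

/-- The scale-invariant form of `IsGrassMeasure.measure_norm_le_eq`. -/
lemma IsGrassMeasure.measure_norm_le_eq_of_ne_zero {n m : ℕ}
    {γ : Measure (Matrix (Fin n) (Fin n) ℝ)} (hγ : IsGrassMeasure n m γ) {x y : Euc n}
    (hx : x ≠ 0) (hy : y ≠ 0) (ρ : ℝ) :
    γ {P | ‖projMap n P x‖ ≤ ρ * ‖x‖} = γ {P | ‖projMap n P y‖ ≤ ρ * ‖y‖} := by
  have hx' := norm_pos_iff.2 hx
  have hy' := norm_pos_iff.2 hy
  have h : ∀ z : Euc n, z ≠ 0 →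
      {P | ‖projMap n P z‖ ≤ ρ * ‖z‖} = {P | ‖projMap n P (‖z‖⁻¹ • z)‖ ≤ ρ} := by
    intro z hz
    have hz' := norm_pos_iff.2 hz
    ext P
    rw [mem_ofPred_eq, mem_ofPred_eq, projMap_smul, norm_smul, norm_inv, norm_norm,
      inv_mul_le_iff₀ hz', mul_comm]
  rw [h x hx, h y hy]
  apply hγ.measure_norm_le_eq
  rw [norm_smul, norm_smul, norm_inv, norm_norm, norm_inv, norm_norm, inv_mul_cancel₀ hx'.ne',
    inv_mul_cancel₀ hy'.ne']

/-- `γ {V : |π_V x| ≤ ρ} ≤ c (ρ / |x|) ^ m`. -/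
lemma IsGrassMeasure.exists_measure_norm_le {n m : ℕ} {γ : Measure (Matrix (Fin n) (Fin n) ℝ)}
    (hγ : IsGrassMeasure n m γ) : ∃ c : ℝ, 1 ≤ c ∧ ∀ (x : Euc n) (ρ : ℝ), x ≠ 0 → 0 ≤ ρ →
      γ {P | ‖projMap n P x‖ ≤ ρ} ≤ ENNReal.ofReal (c * min 1 ((ρ / ‖x‖) ^ (m : ℝ))) := by
  have : IsProbabilityMeasure γ := hγ.1
  set B : Set (Euc n) := closedBall 0 1 with hB
  set v : ℝ := volume.real B with hv
  have hBtop : volume B ≠ ∞ := measure_closedBall_lt_top.ne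
  have hBpos : volume B ≠ 0 := (measure_closedBall_pos volume (0 : Euc n) one_pos).ne'
  have hv0 : 0 < v := ENNReal.toReal_pos hBpos hBtop
  refine ⟨max 1 (2 ^ n / v), le_max_left _ _, fun x ρ hx hρ => ?_⟩
  have hx' := norm_pos_iff.2 hx
  rcases le_total 1 ((ρ / ‖x‖) ^ (m : ℝ)) with h | h
  · rw [min_eq_left h, mul_one]
    exact prob_le_one.trans (ENNReal.one_le_ofReal.2 (le_max_left _ _))
  rw [min_eq_right h]
  set t : ℝ := ρ / ‖x‖ with ht
  have ht0 : 0 ≤ t := by positivity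
  have hρt : ρ = t * ‖x‖ := by rw [ht]; field_simp
  let S : Set (Matrix (Fin n) (Fin n) ℝ × Euc n) :=
    {p | ‖p.2‖ ≤ 1 ∧ ‖projMap n p.1 p.2‖ ≤ t * ‖p.2‖}
  have hS : MeasurableSet S :=
    (measurableSet_le measurable_snd.norm measurable_const).inter
      (measurableSet_le (measurable_projMap_uncurry n).norm (measurable_snd.norm.const_mul t))
  have h1 : (γ.prod volume) S ≤ ENNReal.ofReal (2 ^ n * t ^ m) := by
    rw [Measure.prod_apply hS]
    calc ∫⁻ P, volume (Prod.mk P ⁻¹' S) ∂γ ≤ ∫⁻ _P, ENNReal.ofReal (2 ^ n * t ^ m) ∂γ := by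
          refine lintegral_mono_ae ?_
          filter_upwards [hγ.ae_isProjMat] with P hP
          refine le_trans (measure_mono fun y hy => ?_) (hP.volume_le ht0)
          exact ⟨hy.1, hy.2.trans (mul_le_of_le_one_right ht0 hy.1)⟩
      _ = _ := by simp
  have h2 : (γ.prod volume) S = γ {P | ‖projMap n P x‖ ≤ ρ} * volume B := by
    rw [Measure.prod_apply_symm hS]
    have hn : Nontrivial (Euc n) := ⟨x, 0, hx⟩
    have hae : ∀ᵐ y : Euc n ∂volume, γ ((fun P => (P, y)) ⁻¹' S) =
        B.indicator (fun _ => γ {P | ‖projMap n P x‖ ≤ ρ}) y := by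
      have h0 : ∀ᵐ y : Euc n ∂volume, y ≠ 0 := by
        have := measure_singleton (μ := (volume : Measure (Euc n))) 0
        exact measure_eq_zero_iff_ae_notMem.1 this
      filter_upwards [h0] with y hy
      by_cases hyB : y ∈ B
      · rw [indicator_of_mem hyB, hρt, hγ.measure_norm_le_eq_of_ne_zero hx hy]
        congr 1
        ext P
        have : ‖y‖ ≤ 1 := by simpa [B] using hyB
        simp [S, this]
      · rw [indicator_of_notMem hyB]
        have : ¬ ‖y‖ ≤ 1 := by simpa [B] using hyB
        simp [S, this]
    rw [lintegral_congr_ae hae, lintegral_indicator measurableSet_closedBall]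
    simp [hB]
  rw [h2] at h1
  have h3 : γ {P | ‖projMap n P x‖ ≤ ρ} ≤ ENNReal.ofReal (2 ^ n * t ^ m) / volume B :=
    (ENNReal.le_div_iff_mul_le (Or.inl hBpos) (Or.inl hBtop)).2 h1
  refine h3.trans ?_
  rw [← ENNReal.ofReal_toReal hBtop, ← Measure.real, ← hv, ← ENNReal.ofReal_div_of_pos hv0,
    Real.rpow_natCast]
  refine ENNReal.ofReal_le_ofReal ?_
  calc 2 ^ n * t ^ m / v = 2 ^ n / v * t ^ m := by ring
    _ ≤ _ := by gcongr; exact le_max_right _ _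

/-- A symmetric measurable kernel with values in `[0, 1]`. -/
structure UnitKernel (n : ℕ) (φ : Euc n → ℝ) : Prop where
  meas : Measurable φ
  nonneg : ∀ x, 0 ≤ φ x
  le_one : ∀ x, φ x ≤ 1
  symm : ∀ x y, φ (x - y) = φ (y - x)

/-- The infimal energy, whose reciprocal is the capacity. -/
def minEnergy (n : ℕ) (φ : Euc n → ℝ) (F : Set (Euc n)) : ℝ :=
  sInf {e : ℝ | ∃ μ : Measure (Euc n), PMeasOn n F μ ∧ e = energy n φ μ}

lemma capacity_eq (n : ℕ) (m s θ r : ℝ) (F : Set (Euc n)) :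
    capacity n m s θ r F = (minEnergy n (phiK n m s θ r) F)⁻¹ := rfl

lemma KParam.unitKernel (n : ℕ) {m s θ r : ℝ} (h : KParam m s θ r) :
    UnitKernel n (phiK n m s θ r) where
  meas := (measurable_phiRad m s θ r).comp measurable_norm
  nonneg x := (h.phiRad_pos _).le
  le_one x := h.phiRad_le_one _
  symm x y := by rw [phiK_eq_phiRad, phiK_eq_phiRad, norm_sub_rev]

namespace UnitKernel

variable {n : ℕ} {φ : Euc n → ℝ} (hφ : UnitKernel n φ)
include hφ

lemma integrable_left (μ : Measure (Euc n)) [IsFiniteMeasure μ] (x : Euc n) :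
    Integrable (fun y => φ (x - y)) μ := by
  refine Integrable.of_bound (C := 1)
    (hφ.meas.comp (measurable_const.sub measurable_id)).aestronglyMeasurable ?_
  filter_upwards with y
  rw [Real.norm_eq_abs, abs_of_nonneg (hφ.nonneg _)]
  exact hφ.le_one _

lemma measurable_potential (μ : Measure (Euc n)) [SFinite μ] : Measurable (potential n φ μ) := by
  have : StronglyMeasurable (Function.uncurry fun x y : Euc n => φ (x - y)) :=
    (hφ.meas.comp (measurable_fst.sub measurable_snd)).stronglyMeasurable
  exact (this.integral_prod_right (ν := μ)).measurable

lemma potential_nonneg (μ : Measure (Euc n)) (x : Euc n) : 0 ≤ potential n φ μ x :=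
  integral_nonneg fun _ => hφ.nonneg _

lemma potential_le_one (μ : Measure (Euc n)) [IsProbabilityMeasure μ] (x : Euc n) :
    potential n φ μ x ≤ 1 := by
  have := integral_mono (hφ.integrable_left μ x) (integrable_const 1) fun y => hφ.le_one (x - y)
  rw [integral_const, probReal_univ, one_smul] at this
  exact this

lemma integrable_potential (μ ν : Measure (Euc n)) [IsProbabilityMeasure μ] [IsFiniteMeasure ν] :
    Integrable (potential n φ μ) ν := by
  refine Integrable.of_bound (C := 1) (hφ.measurable_potential μ).aestronglyMeasurable ?_
  filter_upwards with y
  rw [Real.norm_eq_abs, abs_of_nonneg (hφ.potential_nonneg μ _)]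
  exact hφ.potential_le_one μ _

lemma energy_nonneg (μ : Measure (Euc n)) : 0 ≤ energy n φ μ :=
  integral_nonneg fun x => hφ.potential_nonneg μ x

lemma energy_le_one (μ : Measure (Euc n)) [IsProbabilityMeasure μ] : energy n φ μ ≤ 1 := by
  have := integral_mono (hφ.integrable_potential μ μ) (integrable_const 1)
    fun y => hφ.potential_le_one μ y
  rw [integral_const, probReal_univ, one_smul] at this
  exact this

lemma bddBelow (F : Set (Euc n)) :
    BddBelow {e : ℝ | ∃ μ : Measure (Euc n), PMeasOn n F μ ∧ e = energy n φ μ} :=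
  ⟨0, by rintro _ ⟨μ, -, rfl⟩; exact hφ.energy_nonneg μ⟩

omit hφ in
lemma nonempty_energies {F : Set (Euc n)} (hF : F.Nonempty) :
    {e : ℝ | ∃ μ : Measure (Euc n), PMeasOn n F μ ∧ e = energy n φ μ}.Nonempty := by
  obtain ⟨x, hx⟩ := hF
  refine ⟨_, Measure.dirac x, ⟨inferInstance, ?_⟩, rfl⟩
  rw [Measure.dirac_apply]
  simp [hx]

lemma minEnergy_le {F : Set (Euc n)} {μ : Measure (Euc n)} (hμ : PMeasOn n F μ) :
    minEnergy n φ F ≤ energy n φ μ :=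
  csInf_le (hφ.bddBelow F) ⟨μ, hμ, rfl⟩

lemma minEnergy_le_one {F : Set (Euc n)} (hF : F.Nonempty) : minEnergy n φ F ≤ 1 := by
  obtain ⟨_, μ, hμ, rfl⟩ := nonempty_energies (φ := φ) hF
  have := hμ.1
  exact (hφ.minEnergy_le hμ).trans (hφ.energy_le_one μ)

omit hφ in
lemma exists_energy_lt {F : Set (Euc n)} (hF : F.Nonempty) {a : ℝ} (ha : minEnergy n φ F < a) :
    ∃ μ, PMeasOn n F μ ∧ energy n φ μ < a := by
  obtain ⟨_, ⟨μ, hμ, rfl⟩, hlt⟩ := exists_lt_of_csInf_lt (nonempty_energies hF) ha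
  exact ⟨μ, hμ, hlt⟩

lemma minEnergy_mono {ψ : Euc n → ℝ} (hψ : UnitKernel n ψ) {F : Set (Euc n)} (hF : F.Nonempty)
    {c : ℝ} (hc : 0 < c) (h : ∀ x, φ x ≤ c * ψ x) : minEnergy n φ F ≤ c * minEnergy n ψ F := by
  have key : ∀ μ, PMeasOn n F μ → minEnergy n φ F ≤ c * energy n ψ μ := by
    intro μ hμ
    have := hμ.1
    refine (hφ.minEnergy_le hμ).trans ?_
    rw [energy, energy, ← integral_const_mul]
    refine integral_mono (hφ.integrable_potential μ μ)
      ((hψ.integrable_potential μ μ).const_mul c) fun x => ?_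
    dsimp only
    rw [← integral_const_mul]
    exact integral_mono (hφ.integrable_left μ x) ((hψ.integrable_left μ x).const_mul c)
      fun y => h (x - y)
  by_contra! hlt
  rw [← lt_div_iff₀' hc] at hlt
  obtain ⟨μ, hμ, h2⟩ := exists_energy_lt hF hlt
  rw [lt_div_iff₀' hc] at h2
  exact absurd (key μ hμ) h2.not_ge

/-- The energy of a mixture of a measure with a Dirac mass. -/
lemma energy_mix (μ : Measure (Euc n)) [IsProbabilityMeasure μ] (x : Euc n) {t : ℝ}
    (ht0 : 0 ≤ t) (ht1 : t ≤ 1) :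
    energy n φ (ENNReal.ofReal (1 - t) • μ + ENNReal.ofReal t • Measure.dirac x) =
      (1 - t) ^ 2 * energy n φ μ + 2 * t * (1 - t) * potential n φ μ x + t ^ 2 * φ 0 := by
  set ν := ENNReal.ofReal (1 - t) • μ + ENNReal.ofReal t • Measure.dirac x with hν
  have key : ∀ f : Euc n → ℝ, Integrable f μ → Integrable f (Measure.dirac x) →
      ∫ y, f y ∂ν = (1 - t) * ∫ y, f y ∂μ + t * f x := by
    intro f h1 h2
    rw [hν, integral_add_measure (h1.smul_measure ENNReal.ofReal_ne_top)
      (h2.smul_measure ENNReal.ofReal_ne_top), integral_smul_measure, integral_smul_measure,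
      integral_dirac, ENNReal.toReal_ofReal (by linarith), ENNReal.toReal_ofReal ht0]
    rfl
  have hpot : ∀ z, potential n φ ν z = (1 - t) * potential n φ μ z + t * φ (z - x) := fun z =>
    key _ (hφ.integrable_left μ z) (hφ.integrable_left _ z)
  have hright : ∀ ρ : Measure (Euc n), IsFiniteMeasure ρ → Integrable (fun z => φ (z - x)) ρ := by
    intro ρ hρ
    simp only [fun z => hφ.symm z x]
    exact hφ.integrable_left ρ x
  have hint : ∀ ρ : Measure (Euc n), IsFiniteMeasure ρ → Integrable
      (fun z => (1 - t) * potential n φ μ z + t * φ (z - x)) ρ := fun ρ hρ =>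
    ((hφ.integrable_potential μ ρ).const_mul _).add ((hright ρ hρ).const_mul _)
  have h1 : energy n φ ν = ∫ z, ((1 - t) * potential n φ μ z + t * φ (z - x)) ∂ν :=
    integral_congr_ae (ae_of_all _ hpot)
  rw [h1, key _ (hint _ inferInstance) (hint _ inferInstance),
    integral_add ((hφ.integrable_potential μ μ).const_mul _)
      ((hright μ inferInstance).const_mul _), integral_const_mul, integral_const_mul]
  have h2 : ∫ z, φ (z - x) ∂μ = potential n φ μ x := by
    simp only [fun z => hφ.symm z x]
    rfl
  have h3 : ∫ z, potential n φ μ z ∂μ = energy n φ μ := rfl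
  rw [h2, h3, sub_self]
  ring

/-- A measure of almost minimal energy has potential at least half the minimal energy. -/
lemma exists_potential_ge {F : Set (Euc n)} (hF : F.Nonempty) (hpos : 0 < minEnergy n φ F) :
    ∃ μ, PMeasOn n F μ ∧ ∀ x ∈ F, minEnergy n φ F / 2 ≤ potential n φ μ x := by
  set I := minEnergy n φ F with hI
  have hI1 : I ≤ 1 := hφ.minEnergy_le_one hF
  obtain ⟨μ, hμ, hlt⟩ := exists_energy_lt (φ := φ) hF (a := I + I ^ 2 / 8)
    (by rw [← hI]; linarith [pow_pos hpos 2])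
  have hprob := hμ.1
  refine ⟨μ, hμ, fun x hx => ?_⟩
  have ht1 : I / 4 ≤ 1 := by linarith
  have hν : PMeasOn n F (ENNReal.ofReal (1 - I / 4) • μ +
      ENNReal.ofReal (I / 4) • Measure.dirac x) := by
    refine ⟨⟨?_⟩, ?_⟩
    · simp only [Measure.add_apply, Measure.smul_apply, measure_univ, smul_eq_mul, mul_one]
      rw [← ENNReal.ofReal_add (by linarith) (by linarith)]
      simp
    · simp only [Measure.add_apply, Measure.smul_apply, hμ.2, smul_eq_mul, mul_zero, zero_add]
      rw [Measure.dirac_apply]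
      simp [hx]
  have h1 := hφ.minEnergy_le hν
  rw [hφ.energy_mix μ x (by linarith) ht1, ← hI] at h1
  have h2 := hφ.minEnergy_le hμ
  rw [← hI] at h2
  have h3 := hφ.le_one 0
  have h4 := hφ.potential_nonneg μ x
  set e := energy n φ μ
  set u := potential n φ μ x
  by_contra! hu
  have h5 : 2 * (I / 4) * (1 - I / 4) * u ≤ 2 * (I / 4) * u := by
    nlinarith [mul_nonneg hpos.le h4, mul_nonneg hpos.le (mul_nonneg hpos.le h4)]
  have h6 : (1 - I / 4) ^ 2 * e ≤ (1 - I / 4) ^ 2 * (I + I ^ 2 / 8) := by gcongr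
  have h7 : (I / 4) ^ 2 * φ 0 ≤ (I / 4) ^ 2 := mul_le_of_le_one_right (by positivity) h3
  have h8 : 2 * (I / 4) * u < 2 * (I / 4) * (I / 2) := by gcongr
  nlinarith [pow_pos hpos 2, pow_pos hpos 3, mul_pos hpos hpos]

end UnitKernel

lemma coverSum_le_tsum {n : ℕ} {E : Set (Euc n)} {θ s r : ℝ} {ι : Type*} [Countable ι]
    (U : ι → Set (Euc n)) (hE : E ⊆ ⋃ i, U i) (hU : ∀ i, r ≤ diam (U i) ∧ diam (U i) ≤ r ^ θ) :
    coverSum n E θ s r ≤ ∑' i, ENNReal.ofReal (diam (U i) ^ s) := by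
  refine (sInf_le ⟨range U, countable_range U, by rwa [sUnion_range], ?_, rfl⟩ :
    coverSum n E θ s r ≤ _).trans ?_
  · rintro _ ⟨i, rfl⟩
    exact hU i
  · have hg : ∀ V : range U, U (rangeSplitting U V) = V := apply_rangeSplitting U
    calc ∑' V : range U, ENNReal.ofReal (diam (V : Set (Euc n)) ^ s)
        = ∑' V : range U, ENNReal.ofReal (diam (U (rangeSplitting U V)) ^ s) := by
          simp only [hg]
      _ ≤ _ := ENNReal.tsum_comp_le_tsum_of_injective (rangeSplitting_injective U)
          fun i => ENNReal.ofReal (diam (U i) ^ s)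

/-- Only finite covers matter for a lower bound of the covering sum. -/
lemma le_coverSum {n : ℕ} {E : Set (Euc n)} {θ s r : ℝ} (hr : 0 < r) (hs : 0 ≤ s) {c : ℝ≥0∞}
    (h : ∀ 𝒰 : Finset (Set (Euc n)), E ⊆ ⋃ U ∈ 𝒰, U →
      (∀ U ∈ 𝒰, r ≤ diam U ∧ diam U ≤ r ^ θ) → c ≤ ∑ U ∈ 𝒰, ENNReal.ofReal (diam U ^ s)) :
    c ≤ coverSum n E θ s r := by
  refine le_sInf ?_
  rintro _ ⟨𝒰, -, hcov, hdiam, rfl⟩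
  by_cases hfin : 𝒰.Finite
  · lift 𝒰 to Finset (Set (Euc n)) using hfin
    have := h 𝒰 (by simpa [sUnion_eq_biUnion] using hcov) hdiam
    rwa [← Finset.tsum_subtype 𝒰 fun U => ENNReal.ofReal (diam U ^ s)] at this
  · have hinf : Infinite 𝒰 := (infinite_coe_iff).2 hfin
    have h1 : ∑' _U : 𝒰, ENNReal.ofReal (r ^ s) = ∞ :=
      ENNReal.tsum_const_eq_top_of_ne_zero (ENNReal.ofReal_pos.2 (by positivity)).ne'
    refine le_top.trans (h1.symm.le.trans (ENNReal.tsum_le_tsum fun U => ?_))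
    have := (hdiam U U.2).1
    gcongr

/-- The geometric sequence of scales `r ^ (1 - k / N)` has ratio `r ^ (-1 / N)`. -/
lemma exists_scale {r u : ℝ} (hr : 0 < r) (hr1 : r < 1) {N : ℕ} (hN : 0 < N) (h1 : r ≤ u)
    (h2 : u ≤ r⁻¹) : ∃ k ∈ Finset.range (2 * N + 1),
      u ≤ r ^ (1 - k / N : ℝ) ∧ r ^ (1 - k / N : ℝ) ≤ r ^ (-(1 / N) : ℝ) * u := by
  have hN' : (0 : ℝ) < N := by exact_mod_cast hN
  have hu : 0 < u := hr.trans_le h1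
  have hlog : Real.log r < 0 := Real.log_neg hr hr1
  set a := Real.log u / Real.log r with ha
  have hua : u = r ^ a := by
    rw [Real.rpow_def_of_pos hr, ha, mul_div_cancel₀ _ hlog.ne, Real.exp_log hu]
  have ha1 : a ≤ 1 := by
    rw [ha, div_le_one_of_neg hlog]
    exact Real.log_le_log hr h1
  have ha2 : -1 ≤ a := by
    rw [ha, le_div_iff_of_neg hlog]
    have := Real.log_le_log hu h2
    rw [Real.log_inv] at this
    linarith
  have hNa : 0 ≤ N * (1 - a) := mul_nonneg hN'.le (by linarith)
  refine ⟨⌈N * (1 - a)⌉₊, ?_, ?_, ?_⟩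
  · rw [Finset.mem_range, Nat.lt_succ_iff, Nat.ceil_le]
    push_cast
    nlinarith
  · conv_lhs => rw [hua]
    refine Real.rpow_le_rpow_of_exponent_ge hr hr1.le ?_
    have := Nat.le_ceil (N * (1 - a))
    rw [sub_le_comm, le_div_iff₀ hN']
    linarith
  · rw [hua, ← Real.rpow_add hr]
    refine Real.rpow_le_rpow_of_exponent_ge hr hr1.le ?_
    have := (Nat.ceil_lt_add_one hNa).le
    have h3 : (⌈N * (1 - a)⌉₊ : ℝ) / N ≤ (1 - a) + 1 / N := by
      rw [div_le_iff₀ hN']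
      field_simp
      linarith
    linarith

lemma KParam.phiRad_self {m s θ r : ℝ} (h : KParam m s θ r) : phiRad m s θ r r = 1 := by
  have hr := h.r_pos
  refine le_antisymm (h.phiRad_le_one r) (KParam.le_phiRad le_rfl ?_ ?_)
  · rw [div_self hr.ne', Real.one_rpow]
  · rw [one_le_div (by positivity)]
    refine Real.rpow_le_rpow_of_exponent_ge hr h.r_lt_one.le ?_
    nlinarith [h.θ_le_one, h.s_le]

lemma UnitKernel.le_minEnergy {n : ℕ} {φ : Euc n → ℝ} (hφ : UnitKernel n φ) {F : Set (Euc n)}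
    (hF : F.Nonempty) {c : ℝ} (h : ∀ x ∈ F, ∀ y ∈ F, c ≤ φ (x - y)) : c ≤ minEnergy n φ F := by
  refine le_csInf (UnitKernel.nonempty_energies hF) ?_
  rintro _ ⟨μ, hμ, rfl⟩
  have := hμ.1
  have hae : ∀ᵐ x ∂μ, x ∈ F := hμ.2
  have h1 : ∀ f : Euc n → ℝ, Integrable f μ → (∀ x ∈ F, c ≤ f x) → c ≤ ∫ x, f x ∂μ := by
    intro f hf hc
    have := integral_mono_ae (integrable_const c) hf (hae.mono hc)
    simpa using this
  exact h1 _ (hφ.integrable_potential μ μ) fun x hx => h1 _ (hφ.integrable_left μ x) (h x hx)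

/-- A potential which is not small forces a ball of large measure at some scale. -/
lemma exists_large_ball {n m : ℕ} {s θ r : ℝ} (h : KParam m s θ r)
    {P : Matrix (Fin n) (Fin n) ℝ} (hP : IsProjMat n m P) {F : Set (Euc n)} {D : ℝ}
    (hD : ∀ x ∈ F, ∀ y ∈ F, ‖x - y‖ ≤ D) (hDr : D ≤ r⁻¹) {N : ℕ} (hN : 0 < N)
    {μ : Measure (Euc n)} (hμ : PMeasOn n F μ) {I : ℝ} {x : Euc n} (hx : x ∈ F)
    (hpot : I / 2 ≤ potential n (phiK n m s θ r) μ x) :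
    ∃ ρ, r ≤ ρ ∧ ρ ≤ r⁻¹ ∧ I / 2 ≤ (2 * N + 1) * (r ^ (-(m / N) : ℝ) * phiRad m s θ r ρ *
      μ.real (projMap n P ⁻¹' closedBall (projMap n P x) ρ)) := by
  have hprob := hμ.1
  have hr := h.r_pos
  have hr1 := h.r_lt_one
  have hN' : (0 : ℝ) < N := by exact_mod_cast hN
  let ρ : ℕ → ℝ := fun k => r ^ (1 - k / N : ℝ)
  let B : ℕ → Set (Euc n) := fun k => projMap n P ⁻¹' closedBall (projMap n P x) (ρ k)
  have hB : ∀ k, MeasurableSet (B k) := fun k =>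
    (continuous_projMap n P).measurable measurableSet_closedBall
  have hpt : ∀ y ∈ F, phiK n m s θ r (x - y) ≤ ∑ k ∈ Finset.range (2 * N + 1),
      (B k).indicator (fun _ => r ^ (-(m / N) : ℝ) * phiRad m s θ r (ρ k)) y := by
    intro y hy
    set t := ‖projMap n P (x - y)‖ with ht
    have htn : t ≤ ‖x - y‖ := hP.norm_projMap_le _
    have hmax : r ≤ max t r := le_max_right _ _
    have hmax2 : max t r ≤ r⁻¹ := max_le ((htn.trans (hD x hx y hy)).trans hDr)
      (hr1.le.trans ((one_le_inv₀ hr).2 hr1.le))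
    obtain ⟨k, hk, hk1, hk2⟩ := exists_scale hr hr1 hN hmax hmax2
    have hyB : y ∈ B k := by
      rw [mem_preimage, mem_closedBall, dist_comm, dist_eq_norm, projMap_sub]
      exact (le_max_left _ _).trans hk1
    have h1 : phiK n m s θ r (x - y) ≤ phiRad m s θ r (max t r) := by
      rcases le_total r t with hrt | hrt
      · rw [max_eq_left hrt]
        exact h.phiRad_antitone (norm_nonneg _) htn
      · rw [max_eq_right hrt, h.phiRad_self]
        exact h.phiRad_le_one _
    have h2 := h.phiRad_le_mul_of_le
      (Real.one_le_rpow_of_pos_of_le_one_of_nonpos hr hr1.le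
        (neg_nonpos.2 (by positivity : (0 : ℝ) ≤ 1 / N)))
      (hr.trans_le hmax) hk2 (by positivity)
    rw [← Real.rpow_mul hr.le] at h2
    have h3 : (B k).indicator (fun _ => r ^ (-(m / N) : ℝ) * phiRad m s θ r (ρ k)) y =
        r ^ (-(1 / N) * m : ℝ) * phiRad m s θ r (ρ k) := by
      rw [indicator_of_mem hyB]
      congr 2
      ring
    calc _ ≤ _ := h1
      _ ≤ _ := h2
      _ = _ := h3.symm
      _ ≤ _ := Finset.single_le_sum (f := fun k =>
          (B k).indicator (fun _ => r ^ (-(m / N) : ℝ) * phiRad m s θ r (ρ k)) y)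
          (fun j _ => indicator_nonneg
            (fun _ _ => mul_nonneg (by positivity) (h.phiRad_pos _).le) _) hk
  have hae : ∀ᵐ y ∂μ, y ∈ F := hμ.2
  have hint : ∀ k ∈ Finset.range (2 * N + 1), Integrable ((B k).indicator
      (fun _ => r ^ (-(m / N) : ℝ) * phiRad m s θ r (ρ k))) μ := fun k _ =>
    (integrable_const _).indicator (hB k)
  have hsum : I / 2 ≤ ∑ k ∈ Finset.range (2 * N + 1),
      r ^ (-(m / N) : ℝ) * phiRad m s θ r (ρ k) * μ.real (B k) := by
    refine hpot.trans ((integral_mono_ae (h.unitKernel n |>.integrable_left μ x)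
      (integrable_finsetSum _ hint) (hae.mono hpt)).trans_eq ?_)
    rw [integral_finsetSum _ hint]
    refine Finset.sum_congr rfl fun k _ => ?_
    rw [integral_indicator_const _ (hB k), smul_eq_mul, mul_comm]
  have hconst : ∑ _k ∈ Finset.range (2 * N + 1), I / 2 / (2 * N + 1) = I / 2 := by
    rw [Finset.sum_const, Finset.card_range, nsmul_eq_mul]
    push_cast
    field_simp
  obtain ⟨k, hk, hle⟩ := Finset.exists_le_of_sum_le
    (Finset.nonempty_range_iff.2 (Nat.succ_ne_zero _)) (hconst.trans_le hsum)
  have hk' : (k : ℝ) ≤ 2 * N := by exact_mod_cast Nat.lt_succ_iff.1 (Finset.mem_range.1 hk)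
  have hkN : (k : ℝ) / N ≤ 2 := by rw [div_le_iff₀ hN']; exact hk'
  refine ⟨ρ k, ?_, ?_, ?_⟩
  · calc r = r ^ (1 : ℝ) := (Real.rpow_one r).symm
      _ ≤ _ := Real.rpow_le_rpow_of_exponent_ge hr hr1.le (by
        linarith [show 0 ≤ (k : ℝ) / N by positivity])
  · rw [← Real.rpow_neg_one]
    exact Real.rpow_le_rpow_of_exponent_ge hr hr1.le (by linarith)
  · rwa [div_le_iff₀' (by positivity)] at hle

/-- The covering sums of projections are bounded by capacities. -/
lemma coverSum_projMap_le {n m : ℕ} (hn : 0 < n) {s θ r : ℝ} (h : KParam m s θ r)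
    {P : Matrix (Fin n) (Fin n) ℝ} (hP : IsProjMat n m P) {E F : Set (Euc n)} (hEF : E ⊆ F)
    (hF : F.Nonempty) {D : ℝ} (hD : ∀ x ∈ F, ∀ y ∈ F, ‖x - y‖ ≤ D) (hDr : D ≤ r⁻¹) {N : ℕ}
    (hN : 0 < N) (hpos : 0 < minEnergy n (phiK n m s θ r) F) :
    coverSum n (projMap n P '' E) θ s r ≤ ENNReal.ofReal
      ((25 * n) ^ m * (2 * (2 * N + 1)) * r ^ (s - m / N) * capacity n m s θ r F) := by
  have hr := h.r_pos
  have hr1 := h.r_lt_one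
  have hN' : (0 : ℝ) < N := by exact_mod_cast hN
  have hnt : Nontrivial (Euc n) := by
    have : Nonempty (Fin n) := ⟨⟨0, hn⟩⟩
    infer_instance
  obtain ⟨μ, hμ, hpot⟩ := (h.unitKernel n).exists_potential_ge hF hpos
  set I := minEnergy n (phiK n m s θ r) F with hI
  have hprob := hμ.1
  choose! ρ hρ1 hρ2 hρ3 using fun x hx =>
    exists_large_ball h hP hD hDr hN hμ hx (hpot x hx)
  obtain ⟨u, huF, hdisj, hcov⟩ := Vitali.exists_disjoint_subfamily_covering_enlargement_closedBall
    F (projMap n P) ρ r⁻¹ hρ2 5 (by norm_num)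
  let A : u → Set (Euc n) := fun b => projMap n P ⁻¹' closedBall (projMap n P b) (ρ b)
  have hA : ∀ b, MeasurableSet (A b) := fun b =>
    (continuous_projMap n P).measurable measurableSet_closedBall
  have hAd : Pairwise (Function.onFun Disjoint A) := fun b c hbc =>
    (hdisj b.2 c.2 (fun hbc' => hbc (Subtype.ext hbc'))).preimage _
  set M : ℝ := 2 * (2 * N + 1) * r ^ (-(m / N) : ℝ) * I⁻¹ with hM
  have hM0 : 0 ≤ M := by positivity
  have hweight : ∀ b : u, (phiRad m s θ r (ρ b))⁻¹ ≤ M * μ.real (A b) := by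
    intro b
    have h1 := hρ3 b (huF b.2)
    have h2 := h.phiRad_pos (ρ b)
    rw [inv_le_iff_one_le_mul₀ h2, hM]
    calc (1 : ℝ) = I / 2 * (2 * I⁻¹) := by field_simp
      _ ≤ _ * (2 * I⁻¹) := mul_le_mul_of_nonneg_right h1 (by positivity)
      _ = _ := by simp only [A]; ring
  have hApos : ∀ b, 0 < μ (A b) := by
    intro b
    have h1 := (inv_pos.2 (h.phiRad_pos (ρ b))).trans_le (hweight b)
    have h2 : 0 < μ.real (A b) := 
      pos_of_mul_pos_right h1 hM0
    exact (ENNReal.toReal_pos_iff.1 h2).1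
  have hcount : Countable u := by
    have := Measure.countable_meas_pos_of_disjoint_iUnion (μ := μ) hA hAd
    have huniv : {b : u | 0 < μ (A b)} = univ := eq_univ_of_forall hApos
    rw [huniv] at this
    exact countable_univ_iff.1 this
  have hAsum : ∑' b, μ (A b) ≤ 1 := by
    rw [← measure_iUnion hAd hA]
    exact prob_le_one
  let δ : u → ℝ := fun b => min (ρ b) (r ^ θ)
  have hδr : ∀ b, r ≤ δ b := fun b => le_min (hρ1 b (huF b.2)) h.r_le_rpow
  choose Z hZcard hZ using fun b : u =>
    hP.exists_centers hn (hr.trans_le (hδr b)) (min_le_left (ρ b) (r ^ θ)) (b : Euc n)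
  have hdiam : ∀ (b : u) (z : Euc n), diam (closedBall z (δ b / 2)) = δ b := by
    intro b z
    rw [diam_closedBall_eq _ (by linarith [hδr b])]
    ring
  refine (coverSum_le_tsum (ι := Σ b : u, Z b)
    (fun p => closedBall (p.2 : Euc n) (δ p.1 / 2)) ?_ ?_).trans ?_
  · rintro _ ⟨y, hy, rfl⟩
    obtain ⟨b, hb, hsub⟩ := hcov y (hEF hy)
    have h1 := hsub (mem_closedBall_self (hr.le.trans (hρ1 y (hEF hy))))
    rw [mem_closedBall, dist_eq_norm] at h1
    obtain ⟨z, hz, hyz⟩ := hZ ⟨b, hb⟩ y h1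
    exact mem_iUnion.2 ⟨⟨⟨b, hb⟩, ⟨z, hz⟩⟩, by rwa [mem_closedBall, dist_eq_norm]⟩
  · rintro ⟨b, z⟩
    rw [hdiam]
    exact ⟨hδr b, min_le_right _ _⟩
  · simp only [hdiam]
    rw [ENNReal.tsum_sigma']
    have hterm : ∀ b : u, ∑' _z : Z b, ENNReal.ofReal (δ b ^ s) ≤
        ENNReal.ofReal ((25 * n) ^ m * r ^ s * M) * μ (A b) := by
      intro b
      have hδ0 := hr.trans_le (hδr b)
      have h2 := h.cover_weight (hρ1 b (huF b.2))
      rw [Real.rpow_natCast] at h2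
      rw [tsum_fintype, Finset.sum_const, Finset.card_univ, Fintype.card_coe, nsmul_eq_mul,
        ← ofReal_measureReal, ← ENNReal.ofReal_mul (by positivity), ← ENNReal.ofReal_natCast,
        ← ENNReal.ofReal_mul (by positivity)]
      refine ENNReal.ofReal_le_ofReal ?_
      calc ((Z b).card : ℝ) * δ b ^ s ≤ (25 * n * (ρ b / δ b)) ^ m * δ b ^ s := by
            gcongr
            exact hZcard b
        _ = (25 * n) ^ m * ((ρ b / δ b) ^ m * δ b ^ s) := by rw [mul_pow, mul_assoc]
        _ = (25 * n) ^ m * r ^ s * (phiRad m s θ r (ρ b))⁻¹ := by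
            rw [h2, div_eq_mul_inv, mul_assoc]
        _ ≤ (25 * n) ^ m * r ^ s * (M * μ.real (A b)) := by gcongr; exact hweight b
        _ = _ := by ring
    calc _ ≤ ∑' b : u, ENNReal.ofReal ((25 * n) ^ m * r ^ s * M) * μ (A b) :=
          ENNReal.tsum_le_tsum hterm
      _ = ENNReal.ofReal ((25 * n) ^ m * r ^ s * M) * ∑' b, μ (A b) := ENNReal.tsum_mul_left
      _ ≤ ENNReal.ofReal ((25 * n) ^ m * r ^ s * M) := mul_le_of_le_one_right' hAsum
      _ = _ := by
        congr 1
        rw [hM, capacity_eq, ← hI, sub_eq_add_neg, Real.rpow_add hr]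
        ring

/-- The `k`-th scale of a geometric sequence running through `[r, r ^ θ]`. -/
def scale (N : ℕ) (θ r : ℝ) (k : ℕ) : ℝ := min (r ^ (1 - k / N : ℝ)) (r ^ θ)

/-- A weighted sum of indicators of balls at geometric scales, which dominates `t ↦ (r / t) ^ s`
on `[r, r ^ θ]`. -/
def scaleSum (N : ℕ) (s θ r t : ℝ) : ℝ≥0∞ :=
  ∑ k ∈ Finset.range (2 * N + 1),
    (Iic (scale N θ r k)).indicator
      (fun _ => ENNReal.ofReal ((r ^ (-(1 / N) : ℝ) * (r / scale N θ r k)) ^ s)) t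

lemma measurable_scaleSum (N : ℕ) (s θ r : ℝ) : Measurable (scaleSum N s θ r) :=
  Finset.measurable_fun_sum _ fun _ _ => measurable_const.indicator measurableSet_Iic

lemma le_scaleSum {m s θ r : ℝ} (h : KParam m s θ r) {N : ℕ} (hN : 0 < N) {t u : ℝ}
    (hru : r ≤ u) (hur : u ≤ r ^ θ) (htu : t ≤ u) :
    ENNReal.ofReal ((r / u) ^ s) ≤ scaleSum N s θ r t := by
  have hr := h.r_pos
  have hu : 0 < u := hr.trans_le hru
  have hl : 1 < r⁻¹ := (one_lt_inv₀ hr).2 h.r_lt_one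
  obtain ⟨k, hk, h1, h2⟩ := exists_scale hr h.r_lt_one hN hru
    (hur.trans (h.rpow_lt_one.le.trans hl.le))
  have h3 : u ≤ scale N θ r k := le_min h1 hur
  have h4 : scale N θ r k ≤ r ^ (-(1 / N) : ℝ) * u := (min_le_left _ _).trans h2
  have h5 : 0 < scale N θ r k := hu.trans_le h3
  refine le_trans ?_ (Finset.single_le_sum (f := fun k => (Iic (scale N θ r k)).indicator
      (fun _ => ENNReal.ofReal ((r ^ (-(1 / N) : ℝ) * (r / scale N θ r k)) ^ s)) t)
      (fun _ _ => zero_le) hk)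
  rw [indicator_of_mem (show t ∈ Iic (scale N θ r k) from htu.trans h3)]
  refine ENNReal.ofReal_le_ofReal (Real.rpow_le_rpow (by positivity) ?_ h.s_nonneg)
  rw [← mul_div_assoc, div_le_div_iff₀ hu h5]
  nlinarith

lemma KParam.le_scale {m s θ r : ℝ} (h : KParam m s θ r) (N k : ℕ) : r ≤ scale N θ r k := by
  refine le_min ?_ h.r_le_rpow
  conv_lhs => rw [← Real.rpow_one r]
  refine Real.rpow_le_rpow_of_exponent_ge h.r_pos h.r_lt_one.le ?_
  have : (0 : ℝ) ≤ k / N := by positivity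
  linarith

lemma IsGrassMeasure.lintegral_scaleSum_le {n m : ℕ} {γ : Measure (Matrix (Fin n) (Fin n) ℝ)}
    (hγ : IsGrassMeasure n m γ) : ∃ c : ℝ, 1 ≤ c ∧ ∀ {s θ r : ℝ}, KParam m s θ r → ∀ (N : ℕ) x,
      ∫⁻ P, scaleSum N s θ r ‖projMap n P x‖ ∂γ ≤
        ENNReal.ofReal ((2 * N + 1) * (c * r ^ (-(1 / N) * s : ℝ))) *
          ENNReal.ofReal (phiK n m s θ r x) := by
  have := hγ.1
  obtain ⟨c, hc, hball⟩ := hγ.exists_measure_norm_le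
  refine ⟨c, hc, fun {s θ r} h N x => ?_⟩
  have hr := h.r_pos
  have hmeas : Measurable fun P : Matrix (Fin n) (Fin n) ℝ => ‖projMap n P x‖ :=
    ((measurable_projMap_uncurry n).comp (measurable_id.prodMk measurable_const)).norm
  have hpos := h.phiRad_pos ‖x‖
  have hc0 : 0 ≤ c * r ^ (-(1 / N) * s : ℝ) := by positivity
  have key : ∀ k, ∫⁻ P, (Iic (scale N θ r k)).indicator
      (fun _ => ENNReal.ofReal ((r ^ (-(1 / N) : ℝ) * (r / scale N θ r k)) ^ s))
        ‖projMap n P x‖ ∂γ ≤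
      ENNReal.ofReal (c * r ^ (-(1 / N) * s : ℝ) * phiRad m s θ r ‖x‖) := by
    intro k
    set ρ := scale N θ r k with hρ
    have hrρ : r ≤ ρ := h.le_scale N k
    have hρ0 : 0 < ρ := hr.trans_le hrρ
    have h1 : (r ^ (-(1 / N) : ℝ) * (r / ρ)) ^ s = r ^ (-(1 / N) * s : ℝ) * (r / ρ) ^ s := by
      rw [Real.mul_rpow (by positivity) (by positivity), ← Real.rpow_mul hr.le]
    have h2 : ∫⁻ P, (Iic ρ).indicator
        (fun _ => ENNReal.ofReal ((r ^ (-(1 / N) : ℝ) * (r / ρ)) ^ s)) ‖projMap n P x‖ ∂γ =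
        ENNReal.ofReal ((r ^ (-(1 / N) : ℝ) * (r / ρ)) ^ s) * γ {P | ‖projMap n P x‖ ≤ ρ} :=
      lintegral_indicator_const (hmeas measurableSet_Iic) _
    rw [h2, h1]
    rcases eq_or_ne x 0 with rfl | hx
    · have h0 : phiRad m s θ r 0 = 1 := if_pos hr
      rw [norm_zero, h0]
      have h3 : (r / ρ) ^ s ≤ 1 :=
        Real.rpow_le_one (by positivity) ((div_le_one hρ0).2 hrρ) h.s_nonneg
      refine (mul_le_of_le_one_right' prob_le_one).trans (ENNReal.ofReal_le_ofReal ?_)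
      calc _ ≤ r ^ (-(1 / N) * s : ℝ) * 1 := by gcongr
        _ ≤ c * r ^ (-(1 / N) * s : ℝ) * 1 := by
          gcongr
          exact le_mul_of_one_le_left (by positivity) hc
    · refine (mul_le_mul_right (hball x ρ hx hρ0.le) _).trans ?_
      rw [← ENNReal.ofReal_mul (by positivity)]
      refine ENNReal.ofReal_le_ofReal ?_
      calc _ = c * r ^ (-(1 / N) * s : ℝ) * ((r / ρ) ^ s * min 1 ((ρ / ‖x‖) ^ (m : ℝ))) := by
            ring
        _ ≤ _ := by
          gcongr
          exact h.average_weight hrρ (min_le_right _ _) (norm_pos_iff.2 hx)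
  simp only [scaleSum]
  have hterm : ∀ k, Measurable fun P : Matrix (Fin n) (Fin n) ℝ => (Iic (scale N θ r k)).indicator
      (fun _ => ENNReal.ofReal ((r ^ (-(1 / N) : ℝ) * (r / scale N θ r k)) ^ s))
        ‖projMap n P x‖ := fun k => (measurable_const.indicator measurableSet_Iic).comp hmeas
  rw [lintegral_finsetSum _ fun k _ => hterm k]
  refine (Finset.sum_le_sum fun k _ => key k).trans ?_
  rw [Finset.sum_const, Finset.card_range, nsmul_eq_mul, ← ENNReal.ofReal_mul (by positivity),
    ← ENNReal.ofReal_natCast, ← ENNReal.ofReal_mul (by positivity), phiK_eq_phiRad]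
  refine le_of_eq ?_
  congr 1
  push_cast
  ring

/-- The energy of the projection of `μ` with respect to the kernel `scaleSum`. -/
def projEnergy (n N : ℕ) (s θ r : ℝ) (μ : Measure (Euc n)) (P : Matrix (Fin n) (Fin n) ℝ) : ℝ≥0∞ :=
  ∫⁻ z, scaleSum N s θ r ‖projMap n P (z.1 - z.2)‖ ∂μ.prod μ

lemma measurable_scaleSum_projMap (n N : ℕ) (s θ r : ℝ) :
    Measurable fun q : Matrix (Fin n) (Fin n) ℝ × (Euc n × Euc n) =>
      scaleSum N s θ r ‖projMap n q.1 (q.2.1 - q.2.2)‖ :=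
  (measurable_scaleSum N s θ r).comp ((measurable_projMap_uncurry n).comp
    (measurable_fst.prodMk ((measurable_fst.comp measurable_snd).sub
      (measurable_snd.comp measurable_snd)))).norm

lemma measurable_projEnergy (n N : ℕ) (s θ r : ℝ) (μ : Measure (Euc n)) [SFinite μ] :
    Measurable (projEnergy n N s θ r μ) :=
  (measurable_scaleSum_projMap n N s θ r).lintegral_prod_right'

lemma UnitKernel.ofReal_energy {n : ℕ} {φ : Euc n → ℝ} (hφ : UnitKernel n φ)
    (μ : Measure (Euc n)) [IsProbabilityMeasure μ] :
    ENNReal.ofReal (energy n φ μ) = ∫⁻ z, ENNReal.ofReal (φ (z.1 - z.2)) ∂μ.prod μ := by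
  have hm : Measurable fun z : Euc n × Euc n => φ (z.1 - z.2) :=
    hφ.meas.comp (measurable_fst.sub measurable_snd)
  rw [lintegral_prod _ hm.ennreal_ofReal.aemeasurable,
    show energy n φ μ = ∫ x, potential n φ μ x ∂μ from rfl,
    ofReal_integral_eq_lintegral_ofReal (hφ.integrable_potential μ μ)
      (ae_of_all _ fun x => hφ.potential_nonneg μ x)]
  refine lintegral_congr fun x => ?_
  exact ofReal_integral_eq_lintegral_ofReal (hφ.integrable_left μ x)
    (ae_of_all _ fun y => hφ.nonneg _)

lemma lintegral_projEnergy_le {n m N : ℕ} {γ : Measure (Matrix (Fin n) (Fin n) ℝ)} [SFinite γ]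
    {s θ r : ℝ} (h : KParam m s θ r) {C : ℝ≥0∞}
    (hC : ∀ x, ∫⁻ P, scaleSum N s θ r ‖projMap n P x‖ ∂γ ≤
      C * ENNReal.ofReal (phiK n m s θ r x))
    (μ : Measure (Euc n)) [IsProbabilityMeasure μ] :
    ∫⁻ P, projEnergy n N s θ r μ P ∂γ ≤ C * ENNReal.ofReal (energy n (phiK n m s θ r) μ) := by
  have hφ := h.unitKernel n
  have hm : Measurable fun z : Euc n × Euc n => phiK n m s θ r (z.1 - z.2) :=
    hφ.meas.comp (measurable_fst.sub measurable_snd)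
  simp only [projEnergy]
  rw [lintegral_lintegral_swap (measurable_scaleSum_projMap n N s θ r).aemeasurable,
    hφ.ofReal_energy μ, ← lintegral_const_mul _ hm.ennreal_ofReal]
  exact lintegral_mono fun z => hC _

/-- A cover of the projection of `E` yields, by the Cauchy–Schwarz inequality, a lower bound for
the energy of the projection of a measure on the closure of `E`. -/
lemma one_le_sum_mul_projEnergy {n m N : ℕ} (hN : 0 < N) {s θ r : ℝ} (h : KParam m s θ r)
    {E : Set (Euc n)} {μ : Measure (Euc n)} (hμ : PMeasOn n (closure E) μ)
    (P : Matrix (Fin n) (Fin n) ℝ) (𝒰 : Finset (Set (Euc n)))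
    (hcov : projMap n P '' E ⊆ ⋃ U ∈ 𝒰, U)
    (hdiam : ∀ U ∈ 𝒰, r ≤ diam U ∧ diam U ≤ r ^ θ) :
    1 ≤ ENNReal.ofReal (r ^ (-s) * ∑ U ∈ 𝒰, diam U ^ s) * projEnergy n N s θ r μ P := by
  have hprob := hμ.1
  have hr := h.r_pos
  have hcont := continuous_projMap n P
  let e := 𝒰.equivFin
  let U : Fin 𝒰.card → Set (Euc n) := fun i => e.symm i
  have hU : ∀ i, r ≤ diam (U i) ∧ diam (U i) ≤ r ^ θ := fun i => hdiam _ (e.symm i).2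
  let A : Fin 𝒰.card → Set (Euc n) := fun i => projMap n P ⁻¹' closure (U i)
  have hAcl : ∀ i, IsClosed (A i) := fun i => isClosed_closure.preimage hcont
  have hEA : closure E ⊆ ⋃ i, A i := by
    refine closure_minimal (fun x hx => ?_) (isClosed_iUnion_of_finite hAcl)
    obtain ⟨V, hV, hxV⟩ := mem_iUnion₂.1 (hcov ⟨x, hx, rfl⟩)
    refine mem_iUnion.2 ⟨e ⟨V, hV⟩, ?_⟩
    have : U (e ⟨V, hV⟩) = V := by simp [U]
    simp only [A, this]
    exact subset_closure hxV
  let B := disjointed A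
  have hBm : ∀ i, MeasurableSet (B i) := fun i => by
    rw [show B i = A i \ (Finset.Iio i).sup A from disjointed_apply A i,
      Finset.sup_set_eq_biUnion]
    exact (hAcl i).measurableSet.diff
      (Finset.measurableSet_biUnion _ fun j _ => (hAcl j).measurableSet)
  have hBd : Pairwise (Function.onFun Disjoint B) := disjoint_disjointed A
  have hBA : ∀ i, B i ⊆ A i := disjointed_le A
  have hsum : ∑ i, μ.real (B i) = 1 := by
    rw [← measureReal_iUnion_fintype hBd hBm, iUnion_disjointed]
    have h1 : μ (⋃ i, A i) = 1 :=
      (prob_compl_eq_zero_iff (MeasurableSet.iUnion fun i => (hAcl i).measurableSet)).1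
        (measure_mono_null (compl_subset_compl.2 hEA) hμ.2)
    rw [measureReal_def, h1, ENNReal.toReal_one]
  have hX : ∑ i, ENNReal.ofReal ((r / diam (U i)) ^ s * μ.real (B i) ^ 2) ≤
      projEnergy n N s θ r μ P := by
    have hBBd : Pairwise (Function.onFun Disjoint fun i => B i ×ˢ B i) := fun i j hij =>
      Disjoint.set_prod_left (hBd hij) _ _
    calc _ ≤ ∑ i, ∫⁻ z in B i ×ˢ B i, scaleSum N s θ r ‖projMap n P (z.1 - z.2)‖ ∂μ.prod μ := by
          refine Finset.sum_le_sum fun i _ => ?_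
          have h1 : ENNReal.ofReal ((r / diam (U i)) ^ s * μ.real (B i) ^ 2) =
              ∫⁻ _z in B i ×ˢ B i, ENNReal.ofReal ((r / diam (U i)) ^ s) ∂μ.prod μ := by
            have := (hU i).1
            rw [setLIntegral_const, Measure.prod_prod, ENNReal.ofReal_mul (by positivity), sq,
              ENNReal.ofReal_mul (by positivity), ofReal_measureReal]
          rw [h1]
          refine setLIntegral_mono' ((hBm i).prod (hBm i)) fun z hz => ?_
          refine le_scaleSum h hN (hU i).1 (hU i).2 ?_
          have hbdd : Bornology.IsBounded (closure (U i)) := by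
            by_contra hb
            have := diam_eq_zero_of_unbounded hb
            rw [diam_closure] at this
            linarith [(hU i).1]
          rw [← projMap_sub, ← dist_eq_norm, ← diam_closure (U i)]
          exact dist_le_diam_of_mem hbdd (hBA i hz.1) (hBA i hz.2)
      _ = ∫⁻ z in ⋃ i, B i ×ˢ B i, scaleSum N s θ r ‖projMap n P (z.1 - z.2)‖ ∂μ.prod μ := by
          rw [lintegral_iUnion (fun i => (hBm i).prod (hBm i)) hBBd, tsum_fintype]
      _ ≤ _ := setLIntegral_le_lintegral _ _
  have hCS := Finset.sum_sq_le_sum_mul_sum_of_sq_le_mul Finset.univ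
    (r := fun i => μ.real (B i)) (f := fun i => r ^ (-s) * diam (U i) ^ s)
    (g := fun i => (r / diam (U i)) ^ s * μ.real (B i) ^ 2) (fun i _ => by positivity)
    (fun i _ => by positivity) fun i _ => by
      have hd : 0 < diam (U i) := hr.trans_le (hU i).1
      rw [Real.div_rpow hr.le hd.le, Real.rpow_neg hr.le]
      have := Real.rpow_pos_of_pos hd s
      have := Real.rpow_pos_of_pos hr s
      refine le_of_eq ?_
      field_simp
  rw [hsum, one_pow, ← Finset.mul_sum] at hCS
  have hUsum : ∑ i, diam (U i) ^ s = ∑ V ∈ 𝒰, diam V ^ s := by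
    rw [← Finset.sum_coe_sort 𝒰 fun V => diam V ^ s]
    exact Equiv.sum_comp e.symm fun V : 𝒰 => diam (V : Set (Euc n)) ^ s
  rw [hUsum] at hCS
  calc (1 : ℝ≥0∞) ≤ ENNReal.ofReal ((r ^ (-s) * ∑ V ∈ 𝒰, diam V ^ s) *
        ∑ i, (r / diam (U i)) ^ s * μ.real (B i) ^ 2) := by
        rw [← ENNReal.ofReal_one]; exact ENNReal.ofReal_le_ofReal hCS
    _ ≤ _ := by
      rw [ENNReal.ofReal_mul (by positivity), ENNReal.ofReal_sum_of_nonneg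
        (fun i _ => by positivity)]
      gcongr

lemma exists_le_minEnergy {n : ℕ} {F : Set (Euc n)} (hF : F.Nonempty)
    (hb : Bornology.IsBounded F) : ∃ D : ℝ, 1 ≤ D ∧ (∀ x ∈ F, ∀ y ∈ F, ‖x - y‖ ≤ D) ∧
      ∀ {m s θ r : ℝ}, KParam m s θ r → (r / D) ^ m ≤ minEnergy n (phiK n m s θ r) F := by
  have hD : ∀ x ∈ F, ∀ y ∈ F, ‖x - y‖ ≤ max 1 (diam F) := fun x hx y hy => by
    rw [← dist_eq_norm]
    exact (dist_le_diam_of_mem hb hx hy).trans (le_max_right _ _)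
  exact ⟨max 1 (diam F), le_max_left _ _, hD, fun h => (h.unitKernel n).le_minEnergy hF
    fun x hx y hy => h.le_phiRad_of_le (norm_nonneg _) (hD x hx y hy) (le_max_left _ _)⟩

/-- For almost every projection, covers at dyadic scales satisfy the capacity bound. -/
lemma IsGrassMeasure.ae_capacity_le_dyadic {n m : ℕ} {γ : Measure (Matrix (Fin n) (Fin n) ℝ)}
    (hγ : IsGrassMeasure n m γ) {E : Set (Euc n)} (hE : Bornology.IsBounded E)
    (hEne : E.Nonempty) {N : ℕ} (hN : 0 < N) {s θ : ℝ} (hs : s ∈ Icc (0 : ℝ) m)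
    (hθ : θ ∈ Ioc (0 : ℝ) 1) :
    ∀ᵐ P ∂γ, ∃ K : ℝ, 0 < K ∧ ∀ (j : ℕ) (r : ℝ), r = (1 / 2) ^ (j + 1) →
      ∀ 𝒰 : Finset (Set (Euc n)), projMap n P '' E ⊆ ⋃ U ∈ 𝒰, U →
        (∀ U ∈ 𝒰, r ≤ diam U ∧ diam U ≤ r ^ θ) →
        capacity n m s θ r (closure E) ≤
          K * r ^ (-(s + (s + 1) / N) : ℝ) * ∑ U ∈ 𝒰, diam U ^ s := by
  have hprob := hγ.1
  have hN' : (0 : ℝ) < N := by exact_mod_cast hN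
  obtain ⟨c, hc, hX⟩ := hγ.lintegral_scaleSum_le
  obtain ⟨D, hD, -, hI⟩ := exists_le_minEnergy hEne.closure hE.closure
  set R : ℕ → ℝ := fun j => (1 / 2) ^ (j + 1) with hR
  have hR0 : ∀ j, 0 < R j := fun j => by positivity
  have h : ∀ j, KParam m s θ (R j) := fun j =>
    ⟨hR0 j, pow_lt_one₀ (by norm_num) (by norm_num) (Nat.succ_ne_zero j), hθ.1, hθ.2, hs.1, hs.2⟩
  set I : ℕ → ℝ := fun j => minEnergy n (phiK n m s θ (R j)) (closure E) with hI_def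
  have hIpos : ∀ j, 0 < I j := fun j =>
    (Real.rpow_pos_of_pos (div_pos (hR0 j) (by linarith)) _).trans_le (hI (h j))
  choose μ hμ hμI using fun j => UnitKernel.exists_energy_lt (n := n) (φ := phiK n m s θ (R j))
    hEne.closure (a := 2 * I j) (by linarith [hIpos j])
  set B : ℕ → ℝ := fun j => (2 * N + 1) * (c * R j ^ (-(1 / N) * s : ℝ)) with hB
  have hBpos : ∀ j, 0 < B j := fun j => by have := hR0 j; positivity
  set a : ℕ → ℝ := fun j => R j ^ (1 / N : ℝ) / (B j * (2 * I j)) with ha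
  have ha0 : ∀ j, 0 < a j := fun j => by
    have := hR0 j; have := hBpos j; have := hIpos j; positivity
  have hint : ∀ j, ∫⁻ P, ENNReal.ofReal (a j) * projEnergy n N s θ (R j) (μ j) P ∂γ ≤
      ENNReal.ofReal (R j ^ (1 / N : ℝ)) := by
    intro j
    have hpr := (hμ j).1
    rw [lintegral_const_mul _ (measurable_projEnergy n N s θ (R j) (μ j))]
    refine (mul_le_mul_right (lintegral_projEnergy_le (h j) (hX (h j) N) (μ j)) _).trans ?_
    have := hBpos j
    rw [← ENNReal.ofReal_mul this.le, ← ENNReal.ofReal_mul (ha0 j).le]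
    refine ENNReal.ofReal_le_ofReal ?_
    calc a j * (B j * _) ≤ a j * (B j * (2 * I j)) := by
          have := (ha0 j).le; have := (hμI j).le; gcongr
      _ = _ := div_mul_cancel₀ _ (mul_pos this (by linarith [hIpos j])).ne'
  have hsumm : Summable fun j => R j ^ (1 / N : ℝ) := by
    have hq : ∀ j, R j ^ (1 / N : ℝ) = ((1 / 2 : ℝ) ^ (1 / N : ℝ)) ^ (j + 1) := fun j => by
      simp only [hR]
      rw [← Real.rpow_natCast, ← Real.rpow_natCast, ← Real.rpow_mul (by norm_num),
        ← Real.rpow_mul (by norm_num), mul_comm]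
    simp only [hq]
    exact (summable_nat_add_iff 1).2 (summable_geometric_of_lt_one (by positivity)
      (Real.rpow_lt_one (by norm_num) (by norm_num) (by positivity)))
  have hmeas : ∀ j, Measurable fun P =>
      ENNReal.ofReal (a j) * projEnergy n N s θ (R j) (μ j) P := fun j => by
    have hpr := (hμ j).1
    exact (measurable_projEnergy n N s θ (R j) (μ j)).const_mul _
  have hfin : ∫⁻ P, ∑' j, ENNReal.ofReal (a j) * projEnergy n N s θ (R j) (μ j) P ∂γ ≠ ∞ := by
    rw [lintegral_tsum fun j => (hmeas j).aemeasurable]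
    exact ne_top_of_le_ne_top hsumm.tsum_ofReal_ne_top (ENNReal.tsum_le_tsum hint)
  filter_upwards [ae_lt_top (Measurable.tsum hmeas) hfin] with P hP
  set T := ∑' j, ENNReal.ofReal (a j) * projEnergy n N s θ (R j) (μ j) P with hT
  refine ⟨2 * (2 * N + 1) * c * (T.toReal + 1), by positivity, ?_⟩
  rintro j _ rfl 𝒰 hcov hdiam
  change capacity n m s θ (R j) (closure E) ≤ _ * R j ^ _ * _
  set S := ∑ U ∈ 𝒰, diam U ^ s
  have hS : 0 ≤ S := Finset.sum_nonneg fun _ _ => by positivity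
  have hr := hR0 j
  have h1 := one_le_sum_mul_projEnergy hN (h j) (hμ j) P 𝒰 hcov hdiam
  have h2 : ENNReal.ofReal (a j) ≤ ENNReal.ofReal (R j ^ (-s) * S * T.toReal) := by
    calc ENNReal.ofReal (a j) ≤ ENNReal.ofReal (a j) *
          (ENNReal.ofReal (R j ^ (-s) * S) * projEnergy n N s θ (R j) (μ j) P) :=
          le_mul_of_one_le_right' h1
      _ = ENNReal.ofReal (R j ^ (-s) * S) *
          (ENNReal.ofReal (a j) * projEnergy n N s θ (R j) (μ j) P) := by ring
      _ ≤ ENNReal.ofReal (R j ^ (-s) * S) * T := by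
          gcongr
          exact ENNReal.le_tsum j
      _ = _ := by
          rw [ENNReal.ofReal_mul (mul_nonneg (by positivity) hS), ENNReal.ofReal_toReal hP.ne]
  have h3 : a j ≤ R j ^ (-s) * S * T.toReal := (ENNReal.ofReal_le_ofReal_iff (by positivity)).1 h2
  have h4 : (I j)⁻¹ = a j * (2 * B j * R j ^ (-(1 / N) : ℝ)) := by
    have := (hBpos j).ne'
    have := (hIpos j).ne'
    have h5 : R j ^ (1 / N : ℝ) * R j ^ (-(1 / N) : ℝ) = 1 := by
      rw [← Real.rpow_add hr]; simp
    rw [ha]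
    field_simp
    linarith
  have h6 : R j ^ (-(s + (s + 1) / N) : ℝ) =
      R j ^ (-s) * (R j ^ (-(1 / N) * s : ℝ) * R j ^ (-(1 / N) : ℝ)) := by
    rw [← Real.rpow_add hr, ← Real.rpow_add hr]
    congr 1
    ring
  have h7 := (hBpos j).le
  rw [capacity_eq, show minEnergy n (phiK n m s θ (R j)) (closure E) = I j from rfl, h4]
  calc a j * (2 * B j * R j ^ (-(1 / N) : ℝ))
      ≤ R j ^ (-s) * S * T.toReal * (2 * B j * R j ^ (-(1 / N) : ℝ)) := by gcongr
    _ ≤ R j ^ (-s) * S * (T.toReal + 1) * (2 * B j * R j ^ (-(1 / N) : ℝ)) := by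
      gcongr
      linarith
    _ = _ := by
      rw [h6, hB]
      ring

lemma eventually_rpow_le_half_rpow {θ θ' : ℝ} (h : θ' < θ) :
    ∀ᶠ r : ℝ in 𝓝[>] 0, r ^ θ ≤ (r / 2) ^ θ' := by
  have h1 : Tendsto (fun r : ℝ => r ^ (θ - θ')) (𝓝[>] 0) (𝓝 0) := by
    have := (Real.continuous_rpow_const (sub_pos.2 h).le).tendsto 0
    rw [Real.zero_rpow (sub_pos.2 h).ne'] at this
    exact this.mono_left nhdsWithin_le_nhds
  filter_upwards [h1.eventually_lt_const (show (0 : ℝ) < (1 / 2) ^ θ' by positivity),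
    self_mem_nhdsWithin] with r hr hr0
  have hr0 : 0 < r := hr0
  calc r ^ θ = r ^ θ' * r ^ (θ - θ') := by rw [← Real.rpow_add hr0]; congr 1; ring
    _ ≤ r ^ θ' * (1 / 2) ^ θ' := by gcongr
    _ = _ := by rw [← Real.mul_rpow hr0.le (by norm_num)]; congr 1; ring

lemma KParam.capacity_comparison {n : ℕ} {F : Set (Euc n)} (hF : F.Nonempty)
    {m s θ r s' θ' r' : ℝ} (h : KParam m s θ r) (h' : KParam m s' θ' r') (hs : s' ≤ s)
    (hθ : θ' ≤ θ) (hr : r' ≤ r) (hpos : 0 < minEnergy n (phiK n m s' θ' r') F) :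
    capacity n m s θ r F ≤
      r ^ (-((s - s') + (θ - θ') * m)) * capacity n m s' θ' r' F := by
  have hc : 0 < r ^ (-((s - s') + (θ - θ') * m)) := Real.rpow_pos_of_pos h.r_pos _
  have h1 := (h'.unitKernel n).minEnergy_mono (h.unitKernel n) hF hc
    fun x => h.phiRad_comparison h' hs hθ hr ‖x‖
  have h2 : 0 < minEnergy n (phiK n m s θ r) F := pos_of_mul_pos_right (hpos.trans_le h1) hc.le
  rw [capacity_eq, capacity_eq, ← div_eq_mul_inv, inv_eq_one_div, div_le_div_iff₀ h2 hpos, one_mul]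
  exact h1

/-- For almost every projection, the capacity is bounded by the covering sums of the projection,
up to an arbitrarily small power of the scale, for all parameters simultaneously. -/
lemma IsGrassMeasure.ae_eventually_capacity_le {n m : ℕ}
    {γ : Measure (Matrix (Fin n) (Fin n) ℝ)} (hγ : IsGrassMeasure n m γ) {E : Set (Euc n)}
    (hE : Bornology.IsBounded E) (hEne : E.Nonempty) :
    ∀ᵐ P ∂γ, ∀ θ ∈ Ioc (0 : ℝ) 1, ∀ s ∈ Icc (0 : ℝ) m, ∀ δ > 0, ∃ K : ℝ, 0 < K ∧
      ∀ᶠ r in 𝓝[>] 0, ENNReal.ofReal (capacity n m s θ r (closure E)) ≤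
        ENNReal.ofReal (K * r ^ (-(s + δ))) * coverSum n (projMap n P '' E) θ s r := by
  obtain ⟨D, hD, -, hI⟩ := exists_le_minEnergy hEne.closure hE.closure
  have hrat : ∀ᵐ P ∂γ, ∀ (q₁ q₂ : ℚ) (N : ℕ), 0 < N → (q₁ : ℝ) ∈ Icc (0 : ℝ) m →
      (q₂ : ℝ) ∈ Ioc (0 : ℝ) 1 → ∃ K : ℝ, 0 < K ∧ ∀ (j : ℕ) (r : ℝ), r = (1 / 2) ^ (j + 1) →
      ∀ 𝒰 : Finset (Set (Euc n)), projMap n P '' E ⊆ ⋃ U ∈ 𝒰, U →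
        (∀ U ∈ 𝒰, r ≤ diam U ∧ diam U ≤ r ^ (q₂ : ℝ)) →
        capacity n m q₁ q₂ r (closure E) ≤
          K * r ^ (-(q₁ + (q₁ + 1) / N) : ℝ) * ∑ U ∈ 𝒰, diam U ^ (q₁ : ℝ) := by
    simp only [ae_all_iff]
    exact fun q₁ q₂ N hN h1 h2 => hγ.ae_capacity_le_dyadic hE hEne hN h1 h2
  filter_upwards [hrat] with P hP θ hθ s hs δ hδ
  obtain ⟨s', hs'0, hs's, hs'δ⟩ : ∃ q : ℚ, (0 : ℝ) ≤ q ∧ (q : ℝ) ≤ s ∧ s - q ≤ δ / 4 := by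
    rcases hs.1.eq_or_lt with rfl | hpos
    · exact ⟨0, by simp, by simp, by simp; positivity⟩
    · obtain ⟨q, h1, h2⟩ := exists_rat_btwn (max_lt hpos (sub_lt_self s (by positivity : 0 < δ / 4)))
      exact ⟨q, (le_max_left _ _).trans h1.le, h2.le,
        by linarith [(le_max_right 0 (s - δ / 4)).trans h1.le]⟩
  obtain ⟨θ', hθ'1, hθ'θ⟩ := exists_rat_btwn
    (max_lt hθ.1 (sub_lt_self θ (by positivity : 0 < δ / (4 * (m + 1)))))
  have hθ'0 : (0 : ℝ) < θ' := (le_max_left _ _).trans_lt hθ'1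
  have hθ'δ : (θ - θ') * m ≤ δ / 4 := by
    have h1 : θ - θ' ≤ δ / (4 * (m + 1)) := by
      linarith [(le_max_right 0 (θ - δ / (4 * (m + 1)))).trans hθ'1.le]
    have h2 : (m : ℝ) ≤ m + 1 := by linarith
    calc (θ - θ') * m ≤ δ / (4 * (m + 1)) * (m + 1) := by gcongr
      _ = _ := by field_simp
  obtain ⟨N, hN⟩ := exists_nat_gt (4 * (m + 1) / δ)
  have hN0' : (0 : ℝ) < N := lt_of_le_of_lt (by positivity) hN
  have hN0 : 0 < N := by exact_mod_cast hN0'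
  have hNδ : (s' + 1) / N ≤ δ / 4 := by
    rw [div_lt_iff₀ hδ] at hN
    rw [div_le_iff₀ hN0']
    linarith [hs.2]
  obtain ⟨K, hK, hKP⟩ := hP s' θ' N hN0 ⟨hs'0, hs's.trans hs.2⟩ ⟨hθ'0, hθ'θ.le.trans hθ.2⟩
  set a : ℝ := s' + (s' + 1) / N with ha
  have ha0 : 0 ≤ a := by positivity
  refine ⟨K * 2 ^ a, by positivity, ?_⟩
  filter_upwards [eventually_rpow_le_half_rpow hθ'θ, self_mem_nhdsWithin,
    Ioo_mem_nhdsGT (zero_lt_one (α := ℝ))] with r hrθ hr0 hr1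
  have hr0 : 0 < r := hr0
  have hr1 := hr1.2
  obtain ⟨j, hj1, hj2⟩ := exists_nat_pow_near_of_lt_one hr0 hr1.le
    (show (0 : ℝ) < 1 / 2 by norm_num) (by norm_num)
  obtain ⟨R, hR⟩ : ∃ R : ℝ, R = (1 / 2) ^ (j + 1) := ⟨_, rfl⟩
  rw [← hR] at hj1
  have hrR : r / 2 ≤ R := by
    rw [hR, pow_succ]
    linarith
  have hR0 : 0 < R := by linarith
  have h : KParam m s θ r := ⟨hr0, hr1, hθ.1, hθ.2, hs.1, hs.2⟩
  have h' : KParam m s' θ' R := ⟨hR0, hj1.trans hr1, hθ'0, hθ'θ.le.trans hθ.2, hs'0, hs's.trans hs.2⟩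
  have hrRθ : r ^ θ ≤ R ^ (θ' : ℝ) := hrθ.trans (by gcongr)
  have hpos := (Real.rpow_pos_of_pos (div_pos hR0 (by linarith)) _).trans_le (hI h')
  have hcomp := h.capacity_comparison hEne.closure h' hs's hθ'θ.le hj1.le hpos
  set Q : ℝ := K * 2 ^ a * r ^ (-(s + δ)) with hQ
  have hQ0 : 0 < Q := by positivity
  have hcover : ENNReal.ofReal (Q⁻¹ * capacity n m s θ r (closure E)) ≤
      coverSum n (projMap n P '' E) θ s r := by
    refine le_coverSum hr0 hs.1 fun 𝒰 hcov hdiam => ?_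
    rw [← ENNReal.ofReal_sum_of_nonneg fun U _ => by positivity]
    refine ENNReal.ofReal_le_ofReal ?_
    rw [inv_mul_le_iff₀ hQ0]
    have h1 := hKP j R hR 𝒰 hcov fun U hU =>
      ⟨hj1.le.trans (hdiam U hU).1, (hdiam U hU).2.trans hrRθ⟩
    have h2 : ∑ U ∈ 𝒰, diam U ^ (s' : ℝ) ≤ r ^ (-(s - s')) * ∑ U ∈ 𝒰, diam U ^ s := by
      rw [Finset.mul_sum]
      refine Finset.sum_le_sum fun U hU => ?_
      have hd := (hdiam U hU).1
      have hd0 : 0 < diam U := hr0.trans_le hd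
      calc diam U ^ (s' : ℝ) = diam U ^ (-(s - s')) * diam U ^ s := by
            rw [← Real.rpow_add hd0]; congr 1; ring
        _ ≤ _ := mul_le_mul_of_nonneg_right
            (Real.rpow_le_rpow_of_nonpos hr0 hd (by linarith)) (by positivity)
    have h3 : R ^ (-a) ≤ 2 ^ a * r ^ (-a) := by
      calc R ^ (-a) ≤ (r / 2) ^ (-a) :=
            Real.rpow_le_rpow_of_nonpos (by positivity) hrR (by linarith)
        _ = _ := by
          rw [Real.div_rpow hr0.le (by norm_num), Real.rpow_neg (by norm_num : (0 : ℝ) ≤ 2),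
            div_inv_eq_mul, mul_comm]
    set S := ∑ U ∈ 𝒰, diam U ^ s
    have hS : 0 ≤ S := Finset.sum_nonneg fun _ _ => by positivity
    have h4 : r ^ (-((s - s') + (θ - θ') * m)) * (r ^ (-a) * r ^ (-(s - s'))) ≤
        r ^ (-(s + δ)) := by
      rw [← Real.rpow_add hr0, ← Real.rpow_add hr0]
      exact Real.rpow_le_rpow_of_exponent_ge hr0 hr1.le (by linarith)
    calc capacity n m s θ r (closure E) ≤ _ := hcomp
      _ ≤ r ^ (-((s - s') + (θ - θ') * m)) * (K * R ^ (-a) * ∑ U ∈ 𝒰, diam U ^ (s' : ℝ)) := by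
          gcongr
      _ ≤ r ^ (-((s - s') + (θ - θ') * m)) *
          (K * (2 ^ a * r ^ (-a)) * (r ^ (-(s - s')) * S)) := by gcongr
      _ = K * 2 ^ a * (r ^ (-((s - s') + (θ - θ') * m)) * (r ^ (-a) * r ^ (-(s - s')))) * S := by
          ring
      _ ≤ _ := by
          rw [hQ]
          gcongr
  calc ENNReal.ofReal (capacity n m s θ r (closure E))
      = ENNReal.ofReal Q * ENNReal.ofReal (Q⁻¹ * capacity n m s θ r (closure E)) := by
        rw [← ENNReal.ofReal_mul hQ0.le, mul_inv_cancel_left₀ hQ0.ne']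
    _ ≤ _ := by gcongr

lemma eventually_log_div_le {f g : ℝ → ℝ} {K a ε : ℝ} (hK : 0 < K) (hε : 0 < ε)
    (hf : ∀ᶠ r in 𝓝[>] 0, 0 < f r) (hg : ∀ᶠ r in 𝓝[>] 0, 0 < g r)
    (h : ∀ᶠ r in 𝓝[>] 0, f r ≤ K * r ^ (-a) * g r) :
    ∀ᶠ r in 𝓝[>] 0,
      Real.log (f r) / (-Real.log r) ≤ Real.log (g r) / (-Real.log r) + a + ε := by
  have hlog : Tendsto (fun r => -Real.log r) (𝓝[>] 0) atTop :=
    tendsto_neg_atBot_atTop.comp Real.tendsto_log_nhdsGT_zero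
  filter_upwards [hf, hg, h, self_mem_nhdsWithin, hlog.eventually_gt_atTop 0,
    hlog.eventually_ge_atTop (Real.log K / ε)] with r hf hg h hr h0 h1
  have hr : 0 < r := hr
  have hrp : 0 < r ^ (-a) := Real.rpow_pos_of_pos hr _
  have h2 := Real.log_le_log hf h
  rw [Real.log_mul (mul_pos hK hrp).ne' hg.ne', Real.log_mul hK.ne' hrp.ne',
    Real.log_rpow hr] at h2
  rw [div_le_iff₀ hε] at h1
  rw [div_le_iff₀ h0, add_mul, add_mul, div_mul_cancel₀ _ h0.ne']
  linarith

lemma limsup_eq_add_of_tendsto_sub {f g : ℝ → ℝ} {l : Filter ℝ} [l.NeBot] {c : ℝ}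
    (h : Tendsto (fun r => f r - g r) l (𝓝 c)) (hle : l.IsBoundedUnder (· ≤ ·) g)
    (hge : l.IsBoundedUnder (· ≥ ·) g) : limsup f l = limsup g l + c := by
  have hf : f = g + fun r => f r - g r := by ext; simp
  refine le_antisymm ?_ ?_
  · conv_lhs => rw [hf]
    rw [← h.limsup_eq]
    exact limsup_add_le hge hle h.isBoundedUnder_ge.isCoboundedUnder_le h.isBoundedUnder_le
  · have h1 := le_limsup_add hle hge.isCoboundedUnder_le h.isBoundedUnder_le h.isBoundedUnder_ge
    rwa [h.liminf_eq, ← hf] at h1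

lemma liminf_eq_add_of_tendsto_sub {f g : ℝ → ℝ} {l : Filter ℝ} [l.NeBot] {c : ℝ}
    (h : Tendsto (fun r => f r - g r) l (𝓝 c)) (hle : l.IsBoundedUnder (· ≤ ·) g)
    (hge : l.IsBoundedUnder (· ≥ ·) g) : liminf f l = liminf g l + c := by
  have hf : f = (fun r => f r - g r) + g := by ext; simp
  refine le_antisymm ?_ ?_
  · conv_lhs => rw [hf]
    rw [← h.limsup_eq, add_comm (liminf g l)]
    exact liminf_add_le h.isBoundedUnder_ge h.isBoundedUnder_le hge hle.isCoboundedUnder_ge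
  · conv_rhs => rw [hf]
    rw [← h.liminf_eq, add_comm (liminf g l)]
    exact le_liminf_add h.isBoundedUnder_ge h.isBoundedUnder_le hge hle.isCoboundedUnder_ge

lemma eventually_kParam {m s θ : ℝ} (hθ : θ ∈ Ioc (0 : ℝ) 1) (hs : s ∈ Icc 0 m) :
    ∀ᶠ r in 𝓝[>] 0, KParam m s θ r := by
  filter_upwards [Ioo_mem_nhdsGT (zero_lt_one (α := ℝ))] with r hr
  exact ⟨hr.1, hr.2, hθ.1, hθ.2, hs.1, hs.2⟩

lemma eventually_capacity_pos {n : ℕ} {m s θ : ℝ} {F : Set (Euc n)} (hF : F.Nonempty)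
    (hb : Bornology.IsBounded F) (hθ : θ ∈ Ioc (0 : ℝ) 1) (hs : s ∈ Icc 0 m) :
    ∀ᶠ r in 𝓝[>] 0, 0 < capacity n m s θ r F := by
  obtain ⟨D, hD, -, hI⟩ := exists_le_minEnergy hF hb
  filter_upwards [eventually_kParam hθ hs] with r h
  exact inv_pos.2 ((Real.rpow_pos_of_pos (div_pos h.r_pos (by linarith)) _).trans_le (hI h))

lemma eventually_Cquot_mem {n : ℕ} {m s θ : ℝ} {F : Set (Euc n)} (hF : F.Nonempty)
    (hb : Bornology.IsBounded F) (hθ : θ ∈ Ioc (0 : ℝ) 1) (hs : s ∈ Icc 0 m) :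
    ∀ᶠ r in 𝓝[>] 0, Cquot n m s θ F r ∈ Icc 0 (m + 1) := by
  obtain ⟨D, hD, -, hI⟩ := exists_le_minEnergy hF hb
  have hupper : ∀ᶠ r in 𝓝[>] 0, capacity n m s θ r F ≤ D ^ m * r ^ (-m) * 1 := by
    filter_upwards [eventually_kParam hθ hs] with r h
    have h1 : 0 < r / D := div_pos h.r_pos (by linarith)
    rw [capacity_eq, mul_one]
    refine (inv_anti₀ (Real.rpow_pos_of_pos h1 m) (hI h)).trans_eq ?_
    rw [Real.div_rpow h.r_pos.le (by linarith), inv_div, Real.rpow_neg h.r_pos.le, div_eq_mul_inv]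
  filter_upwards [eventually_kParam hθ hs, eventually_capacity_pos hF hb hθ hs,
    eventually_log_div_le (g := fun _ => 1) (by positivity) one_pos
      (eventually_capacity_pos hF hb hθ hs) (Eventually.of_forall fun _ => one_pos) hupper]
    with r h hpos hle
  refine ⟨div_nonneg (Real.log_nonneg ?_) (neg_nonneg.2 (Real.log_neg h.r_pos h.r_lt_one).le), ?_⟩
  · exact (one_le_inv₀ (inv_pos.1 hpos)).2 ((h.unitKernel n).minEnergy_le_one hF)
  · simpa [Cquot] using hle

/-- The exponents of covering sums of a projection and of capacities differ by `s` in the limit. -/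
lemma tendsto_Squot_sub_Cquot {n m : ℕ} (hn : 0 < n) {E : Set (Euc n)}
    (hE : Bornology.IsBounded E) (hEne : E.Nonempty) {P : Matrix (Fin n) (Fin n) ℝ}
    (hP : IsProjMat n m P) {s θ : ℝ} (hθ : θ ∈ Ioc (0 : ℝ) 1) (hs : s ∈ Icc (0 : ℝ) m)
    (hlower : ∀ δ > 0, ∃ K : ℝ, 0 < K ∧
      ∀ᶠ r in 𝓝[>] 0, ENNReal.ofReal (capacity n m s θ r (closure E)) ≤
        ENNReal.ofReal (K * r ^ (-(s + δ))) * coverSum n (projMap n P '' E) θ s r) :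
    Tendsto (fun r => Squot n (projMap n P '' E) θ s r - Cquot n m s θ (closure E) r)
      (𝓝[>] 0) (𝓝 (-s)) := by
  have hcap := eventually_capacity_pos hEne.closure hE.closure hθ hs
  obtain ⟨D, hD1, hD, -⟩ := exists_le_minEnergy hEne.closure hE.closure
  have hDr : ∀ᶠ r : ℝ in 𝓝[>] 0, D ≤ r⁻¹ := tendsto_inv_nhdsGT_zero.eventually_ge_atTop D
  have hupper : ∀ N : ℕ, 0 < N → ∀ᶠ r in 𝓝[>] 0, coverSum n (projMap n P '' E) θ s r ≤
      ENNReal.ofReal ((25 * n) ^ m * (2 * (2 * N + 1)) * r ^ (-(-(s - m / N))) *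
        capacity n m s θ r (closure E)) := by
    intro N hN
    filter_upwards [eventually_kParam hθ hs, hcap, hDr] with r h hpos hDr
    rw [neg_neg]
    exact coverSum_projMap_le hn h hP subset_closure hEne.closure hD hDr hN (inv_pos.1 hpos)
  have hfin : ∀ᶠ r in 𝓝[>] 0, coverSum n (projMap n P '' E) θ s r ≠ ∞ :=
    (hupper 1 one_pos).mono fun r hr => ne_top_of_le_ne_top ENNReal.ofReal_ne_top hr
  have hlower' : ∀ δ > 0, ∃ K : ℝ, 0 < K ∧ ∀ᶠ r in 𝓝[>] 0, capacity n m s θ r (closure E) ≤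
      K * r ^ (-(s + δ)) * Sval n (projMap n P '' E) θ s r := by
    intro δ hδ
    obtain ⟨K, hK, hKr⟩ := hlower δ hδ
    refine ⟨K, hK, ?_⟩
    filter_upwards [hKr, hfin, self_mem_nhdsWithin] with r hr hfin hr0
    have hr0 : 0 < r := hr0
    have h1 : 0 ≤ K * r ^ (-(s + δ)) := by positivity
    rw [← ENNReal.ofReal_toReal hfin, ← ENNReal.ofReal_mul h1] at hr
    exact (ENNReal.ofReal_le_ofReal_iff (mul_nonneg h1 ENNReal.toReal_nonneg)).1 hr
  have hSpos : ∀ᶠ r in 𝓝[>] 0, 0 < Sval n (projMap n P '' E) θ s r := by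
    obtain ⟨K, hK, hKr⟩ := hlower' 1 one_pos
    filter_upwards [hKr, hcap, self_mem_nhdsWithin] with r hr hpos hr0
    have hr0 : 0 < r := hr0
    exact pos_of_mul_pos_right (hpos.trans_le hr) (by positivity)
  rw [tendsto_order]
  refine ⟨fun a ha => ?_, fun b hb => ?_⟩
  · obtain ⟨K, hK, hKr⟩ := hlower' ((-s - a) / 3) (by linarith)
    filter_upwards [eventually_log_div_le hK (show 0 < (-s - a) / 3 by linarith) hcap hSpos hKr]
      with r hr
    simp only [Squot, Cquot]
    linarith
  · obtain ⟨N, hN⟩ := exists_nat_gt (3 * m / (b + s))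
    have hN0' : (0 : ℝ) < N :=
      lt_of_le_of_lt (div_nonneg (by positivity) (by linarith)) hN
    have hN0 : 0 < N := by exact_mod_cast hN0'
    have hmN : (m : ℝ) / N < (b + s) / 3 := by
      rw [div_lt_iff₀ (by linarith)] at hN
      rw [div_lt_iff₀ hN0']
      linarith
    have h1 : ∀ᶠ r in 𝓝[>] 0, Sval n (projMap n P '' E) θ s r ≤
        (25 * n) ^ m * (2 * (2 * N + 1)) * r ^ (-(-(s - m / N))) *
          capacity n m s θ r (closure E) := by
      filter_upwards [hupper N hN0, hcap, self_mem_nhdsWithin] with r hr hpos hr0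
      have hr0 : 0 < r := hr0
      exact ENNReal.toReal_le_of_le_ofReal (by positivity) hr
    have hn' : (0 : ℝ) < n := by exact_mod_cast hn
    filter_upwards [eventually_log_div_le (by positivity) (show 0 < (b + s) / 3 by linarith)
      hSpos hcap h1] with r hr
    simp only [Squot, Cquot]
    linarith

/-- For `γ_{n,m}`-almost every `V ∈ G(n,m)`, simultaneously for all
`θ ∈ (0,1]`, the intermediate dimensions of `π_V E` equal the corresponding intermediate
dimension profiles of `E`. -/
theorem statement13 (n m : ℕ) (hm1 : 1 ≤ m) (hmn : m ≤ n - 1)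
    (E : Set (Euc n)) (hE : Bornology.IsBounded E) (hEne : E.Nonempty)
    (γ : Measure (Matrix (Fin n) (Fin n) ℝ)) (hγ : IsGrassMeasure n m γ) :
    ∀ᵐ P ∂γ, ∀ θ : ℝ, θ ∈ Ioc (0:ℝ) 1 →
      (∀ d : ℝ, IsLowerDimProfile n m θ E d → IsLowerInterDim n θ (projMap n P '' E) d) ∧
      (∀ d : ℝ, IsUpperDimProfile n m θ E d → IsUpperInterDim n θ (projMap n P '' E) d) := by
  have hn : 0 < n := by omega
  have hIcc : ∀ {d : ℝ}, d ∈ Icc (0 : ℝ) m → d ∈ Icc (0 : ℝ) n := fun hd =>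
    ⟨hd.1, hd.2.trans (by exact_mod_cast (by omega : m ≤ n))⟩
  filter_upwards [hγ.ae_isProjMat, hγ.ae_eventually_capacity_le hE hEne] with P hP hlower θ hθ
  have hlim := fun {d : ℝ} (hd : d ∈ Icc (0 : ℝ) m) =>
    tendsto_Squot_sub_Cquot hn hE hEne hP hθ hd (hlower θ hθ d hd)
  have hmem := fun {d : ℝ} (hd : d ∈ Icc (0 : ℝ) m) =>
    eventually_Cquot_mem hEne.closure hE.closure hθ hd
  refine ⟨fun d hd => ⟨hIcc hd.1, ?_⟩, fun d hd => ⟨hIcc hd.1, ?_⟩⟩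
  · rw [liminf_eq_add_of_tendsto_sub (hlim hd.1)
      (isBoundedUnder_of_eventually_le ((hmem hd.1).mono fun _ h => h.2))
      (isBoundedUnder_of_eventually_ge ((hmem hd.1).mono fun _ h => h.1)), hd.2, add_neg_cancel]
  · rw [limsup_eq_add_of_tendsto_sub (hlim hd.1)
      (isBoundedUnder_of_eventually_le ((hmem hd.1).mono fun _ h => h.2))
      (isBoundedUnder_of_eventually_ge ((hmem hd.1).mono fun _ h => h.1)), hd.2, add_neg_cancel]
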